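/- Assume the Riemann hypothesis. Fix y > 0 and δ ∈ (1/2, 1). Then the limit as X → ∞ of P̃₋(y, X, δ) := (log X / X^δ) · Σ_{N prime, X ≤ N ≤ X + X^δ} Σ_{χ ∈ D₋(N)} χ(⌈yX⌉^𝔭)/τ(χ) exists and equals −i · sin(2πy). -/

import Mathlib

open Filter Topology Finset

/-- The Riemann hypothesis: every zero of the Riemann zeta function with real part
strictly between `0` and `1` has real part `1/2`. -/
def RiemannHypothesis' : Prop :=
  ∀ s : ℂ, riemannZeta s = 0 → 0 < s.re → s.re < 1 → s.re = 1 / 2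

/-- `⌈x⌉^𝔭`: the smallest prime number that is `≥ x`. -/
noncomputable def leastPrime (x : ℝ) : ℕ := sInf {p : ℕ | p.Prime ∧ x ≤ (p : ℝ)}

/-- The Gauss sum `τ(χ) = Σ_{b=1}^{N} χ(b) e^{2πib/N}`. -/
noncomputable def gaussSum' {N : ℕ} (χ : DirichletCharacter ℂ N) : ℂ :=
  ∑ b ∈ Finset.Icc 1 N,
    χ ((b : ℕ) : ZMod N) * Complex.exp (2 * Real.pi * Complex.I * (b : ℂ) / (N : ℂ))

/-- `P̃₋(y, X, δ)`. -/
noncomputable def PminusTilde (y X δ : ℝ) : ℂ :=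
  (Complex.ofReal (Real.log X / X ^ δ)) *
    ∑ N ∈ (Finset.range (Nat.floor (X + X ^ δ) + 1)).filter
        (fun N : ℕ => N.Prime ∧ X ≤ (N : ℝ) ∧ (N : ℝ) ≤ X + X ^ δ),
      ∑ᶠ χ ∈ {χ : DirichletCharacter ℂ N | χ.IsPrimitive ∧ χ (-1) = -1},
        χ ((leastPrime (y * X) : ℕ) : ZMod N) / gaussSum' χ

namespace Murmuration

lemma gaussSum'_eq_gaussSum {N : ℕ} [NeZero N] (χ : DirichletCharacter ℂ N) :
    gaussSum' χ = gaussSum χ ZMod.stdAddChar := by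
  have hN : 0 < N := Nat.pos_of_ne_zero (NeZero.ne N)
  unfold gaussSum' gaussSum
  refine Finset.sum_bij (fun b _ => (b : ZMod N)) (fun _ _ => Finset.mem_univ _) ?_ ?_ ?_
  · intro a ha b hb h
    rw [Finset.mem_Icc] at ha hb
    rw [ZMod.natCast_eq_natCast_iff, Nat.modEq_iff_dvd] at h
    obtain ⟨k, hk⟩ := h
    have h1 : k < 1 := by
      by_contra! hk1
      nlinarith [mul_le_mul_of_nonneg_left hk1 (Int.natCast_nonneg N)]
    have h2 : -1 < k := by
      by_contra! hk1
      nlinarith [mul_le_mul_of_nonneg_left hk1 (Int.natCast_nonneg N)]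
    obtain rfl : k = 0 := by omega
    simp only [mul_zero] at hk
    omega
  · intro b _
    rcases Nat.eq_zero_or_pos b.val with h | h
    · exact ⟨N, by simp; omega, by simpa using ((ZMod.val_eq_zero b).1 h).symm⟩
    · exact ⟨b.val, by simp [Nat.succ_le_of_lt h, (ZMod.val_lt b).le], by simp⟩
  · intro b _
    congr 1
    simpa using (ZMod.stdAddChar_coe (N := N) b).symm

lemma inv_gaussSum_of_odd {N : ℕ} [Fact N.Prime] {χ : DirichletCharacter ℂ N} (hχ : χ (-1) = -1) :
    (gaussSum χ ZMod.stdAddChar)⁻¹ = -(gaussSum χ⁻¹ ZMod.stdAddChar) / N := by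
  have hN : (N : ℂ) ≠ 0 := Nat.cast_ne_zero.2 (NeZero.ne N)
  have h1 : χ ≠ 1 := by
    rintro rfl
    rw [MulChar.one_apply (by simp)] at hχ
    norm_num at hχ
  have h2 := gaussSum_mul_gaussSum_eq_card h1 (ZMod.isPrimitive_stdAddChar N)
  have h3 := mul_gaussSum_inv_eq_gaussSum χ⁻¹ (ZMod.stdAddChar (N := N))
  have h4 : χ⁻¹ (-1) = -1 := by
    rw [MulChar.inv_apply_eq_inv, hχ]
    norm_num
  rw [h4] at h3
  rw [ZMod.card] at h2
  refine inv_eq_of_mul_eq_one_right ?_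
  rw [← h3, neg_one_mul, neg_neg, ← mul_div_assoc, h2, div_self hN]

lemma isPrimitive_of_odd {N : ℕ} (hN : N.Prime) {χ : DirichletCharacter ℂ N}
    (hχ : χ (-1) = -1) : χ.IsPrimitive := by
  have : NeZero N := ⟨hN.ne_zero⟩
  rw [DirichletCharacter.isPrimitive_def]
  rcases (Nat.dvd_prime hN).1 χ.conductor_dvd_level with h | h
  · rw [← DirichletCharacter.eq_one_iff_conductor_eq_one] at h
    subst h
    rw [MulChar.one_apply (by simp)] at hχ
    norm_num at hχ
  · exact h

/-- The sum over odd characters detects `b = a` minus `b = -a`. -/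
lemma sum_char_mul_inv_odd {N : ℕ} [Fact N.Prime] {a b : ZMod N} (ha : a ≠ 0) :
    ∑ χ : DirichletCharacter ℂ N, (1 - χ (-1)) * (χ a * χ⁻¹ b) =
      (N - 1 : ℂ) * ((if b = a then 1 else 0) - (if b = -a then 1 else 0)) := by
  have hcard : ((N.totient : ℕ) : ℂ) = N - 1 := by
    have := (Fact.out : N.Prime)
    rw [Nat.totient_prime this, Nat.cast_sub this.one_lt.le, Nat.cast_one]
  rcases eq_or_ne b 0 with rfl | hb
  · rw [if_neg (Ne.symm ha), if_neg (by simpa [eq_comm] using ha)]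
    simp [MulChar.map_zero]
  · have key (c : ZMod N) : ∑ χ : DirichletCharacter ℂ N, χ c * χ⁻¹ b =
        if b = c then (N - 1 : ℂ) else 0 := by
      rw [← hcard, ← DirichletCharacter.sum_char_inv_mul_char_eq ℂ (isUnit_iff_ne_zero.2 hb)]
      refine Finset.sum_congr rfl fun χ _ => ?_
      rw [MulChar.inv_apply', mul_comm]
    have h : ∀ χ : DirichletCharacter ℂ N, (1 - χ (-1)) * (χ a * χ⁻¹ b) =
        χ a * χ⁻¹ b - χ (-a) * χ⁻¹ b := by
      intro χ
      rw [← neg_one_mul a, map_mul]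
      ring
    simp only [h, Finset.sum_sub_distrib, key, mul_sub, mul_ite, mul_one, mul_zero]

lemma sum_odd_char_div_gaussSum {N : ℕ} (hN : N.Prime) (p : ℕ) :
    ∑ᶠ χ ∈ {χ : DirichletCharacter ℂ N | χ.IsPrimitive ∧ χ (-1) = -1},
        χ (p : ZMod N) / gaussSum' χ =
      -Complex.I * (((N - 1) / N * Real.sin (2 * Real.pi * (p / N)) : ℝ) : ℂ) := by
  classical
  have : Fact N.Prime := ⟨hN⟩
  have hN0 : (N : ℂ) ≠ 0 := Nat.cast_ne_zero.2 hN.ne_zero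
  rw [finsum_mem_def, finsum_eq_sum_of_fintype]
  have hterm : ∀ χ : DirichletCharacter ℂ N,
      Set.indicator {χ : DirichletCharacter ℂ N | χ.IsPrimitive ∧ χ (-1) = -1}
        (fun χ => χ (p : ZMod N) / gaussSum' χ) χ =
      ∑ b : ZMod N, (-1 / (2 * N) * ZMod.stdAddChar b) *
        ((1 - χ (-1)) * (χ (p : ZMod N) * χ⁻¹ b)) := by
    intro χ
    by_cases hχ : χ (-1) = -1
    · have hmem : χ ∈ {χ : DirichletCharacter ℂ N | χ.IsPrimitive ∧ χ (-1) = -1} :=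
        ⟨isPrimitive_of_odd hN hχ, hχ⟩
      rw [Set.indicator_of_mem hmem, gaussSum'_eq_gaussSum, div_eq_mul_inv,
        inv_gaussSum_of_odd hχ, hχ, gaussSum, neg_div, Finset.sum_div, mul_neg, Finset.mul_sum,
        ← Finset.sum_neg_distrib]
      refine Finset.sum_congr rfl fun b _ => ?_
      field_simp
      ring
    · rw [Set.indicator_of_notMem (fun h => hχ h.2)]
      have h1 : χ (-1) * χ (-1) = 1 := by rw [← map_mul]; simp
      have h2 : χ (-1) = 1 := (mul_self_eq_one_iff.1 h1).resolve_right hχ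
      simp [h2]
  rw [Finset.sum_congr rfl fun χ _ => hterm χ, Finset.sum_comm]
  simp only [← Finset.mul_sum]
  by_cases hp : (p : ZMod N) = 0
  · obtain ⟨k, rfl⟩ := (ZMod.natCast_eq_zero_iff p N).1 hp
    have : Real.sin (2 * Real.pi * (((N * k : ℕ) : ℝ) / N)) = 0 := by
      have hN0' : (N : ℝ) ≠ 0 := Nat.cast_ne_zero.2 hN.ne_zero
      rw [Nat.cast_mul, mul_div_cancel_left₀ _ hN0',
        show 2 * Real.pi * (k : ℝ) = ((2 * k : ℕ) : ℝ) * Real.pi by push_cast; ring]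
      exact Real.sin_nat_mul_pi _
    rw [this, hp]
    simp [MulChar.map_zero]
  · simp only [sum_char_mul_inv_odd hp]
    simp only [mul_sub, mul_ite, mul_one, mul_zero, Finset.sum_sub_distrib, Finset.sum_ite_eq',
      Finset.mem_univ, if_true]
    have h1 : (ZMod.stdAddChar (N := N) (p : ZMod N)) =
        Complex.exp (2 * Real.pi * (p / N) * Complex.I) := by
      have := ZMod.stdAddChar_coe (N := N) p
      rw [Int.cast_natCast] at this
      rw [this]; congr 1; push_cast; ring
    have h2 : (ZMod.stdAddChar (N := N) (-(p : ZMod N))) =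
        Complex.exp (-(2 * Real.pi * (p / N)) * Complex.I) := by
      have := ZMod.stdAddChar_coe (N := N) (-p)
      rw [Int.cast_neg, Int.cast_natCast] at this
      rw [this]; congr 1; push_cast; ring
    rw [h1, h2]
    push_cast
    rw [Complex.sin]
    field_simp
    rw [show (Complex.I)^2 = -1 from Complex.I_sq]
    ring

lemma hasDerivAt_ofReal_cpow {x : ℝ} (hx : 0 < x) (r : ℂ) :
    HasDerivAt (fun y : ℝ => (y : ℂ) ^ r) (r * (x : ℂ) ^ (r - 1)) x := by
  have h := ((hasDerivAt_id (x : ℂ)).cpow_const (c := r)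
    (Complex.ofReal_mem_slitPlane.2 hx)).comp_ofReal
  simpa using h

lemma norm_ofReal_cpow_sub_le {a b C : ℝ} (ha : 0 < a) (hab : a ≤ b) (r : ℂ)
    (hC : ∀ x ∈ Set.Icc a b, x ^ (r.re - 1) ≤ C) :
    ‖(b : ℂ) ^ r - (a : ℂ) ^ r‖ ≤ ‖r‖ * C * (b - a) := by
  refine norm_image_sub_le_of_norm_deriv_le_segment' (f := fun y : ℝ => (y : ℂ) ^ r)
    (f' := fun x : ℝ => r * (x : ℂ) ^ (r - 1)) (fun x hx => ?_) (fun x hx => ?_) b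
    (Set.right_mem_Icc.2 hab)
  · exact (hasDerivAt_ofReal_cpow (ha.trans_le hx.1) r).hasDerivWithinAt
  · rw [norm_mul, Complex.norm_cpow_eq_rpow_re_of_pos (ha.trans_le hx.1)]
    exact mul_le_mul_of_nonneg_left (by simpa using hC x ⟨hx.1, hx.2.le⟩) (norm_nonneg _)

/-- The entire function `(s - 1) ζ(s)`. -/
noncomputable def zetaReg : ℂ → ℂ :=
  Function.update (fun s => (s - 1) * riemannZeta s) 1 1

lemma zetaReg_of_ne {s : ℂ} (hs : s ≠ 1) : zetaReg s = (s - 1) * riemannZeta s :=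
  Function.update_of_ne hs ..

lemma zetaReg_one : zetaReg 1 = 1 := Function.update_self ..

lemma differentiable_zetaReg : Differentiable ℂ zetaReg := by
  rw [← differentiableOn_univ,
    ← Complex.differentiableOn_compl_singleton_and_continuousAt_iff (c := 1) Filter.univ_mem]
  refine ⟨DifferentiableOn.congr (f := fun s ↦ (s - 1) * riemannZeta s)
    (fun s hs ↦ ?_) fun _ hs ↦ zetaReg_of_ne hs.2, continuousWithinAt_compl_self.mp ?_⟩
  · exact ((differentiableAt_id.sub_const 1).mul
      (differentiableAt_riemannZeta hs.2)).differentiableWithinAt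
  · have h :
        ContinuousWithinAt (Function.update (fun s => (s - 1) * riemannZeta s) 1 1) {1}ᶜ 1 := by
      simpa using riemannZeta_residue_one
    exact h

lemma zetaReg_ne_zero (hRH : RiemannHypothesis') {s : ℂ} (hs : 1 / 2 < s.re) :
    zetaReg s ≠ 0 := by
  rcases eq_or_ne s 1 with rfl | h1
  · simp [zetaReg_one]
  · rw [zetaReg_of_ne h1]
    refine mul_ne_zero (sub_ne_zero.2 h1) fun h => ?_
    rcases lt_or_ge s.re 1 with h2 | h2
    · exact hs.ne' (hRH s h (by linarith) h2)
    · exact riemannZeta_ne_zero_of_one_le_re h2 h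

/-- The terms of the Euler-Maclaurin series for `(s - 1) ζ(s) - 1`. -/
noncomputable def zetaTerm (n : ℕ) (s : ℂ) : ℂ :=
  (s - 1) * ((n + 1 : ℝ) : ℂ) ^ (-s) +
    (((n + 2 : ℝ) : ℂ) ^ (1 - s) - ((n + 1 : ℝ) : ℂ) ^ (1 - s))

lemma norm_zetaTerm_le (n : ℕ) {s : ℂ} (hs : 0 < s.re) :
    ‖zetaTerm n s‖ ≤ ‖s - 1‖ * ‖s‖ * (n + 1 : ℝ) ^ (-s.re - 1) := by
  set a : ℝ := n + 1 with ha
  have ha0 : 0 < a := by positivity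
  have key := norm_image_sub_le_of_norm_deriv_le_segment' (a := a) (b := a + 1)
    (f := fun x : ℝ => (s - 1) * (a : ℂ) ^ (-s) * x + (x : ℂ) ^ (1 - s))
    (f' := fun x : ℝ => (s - 1) * (a : ℂ) ^ (-s) * 1 + (1 - s) * (x : ℂ) ^ (1 - s - 1))
    (C := ‖s - 1‖ * ‖s‖ * a ^ (-s.re - 1)) (fun x hx => ?_) (fun x hx => ?_) (a + 1)
    (Set.right_mem_Icc.2 (by linarith))
  · have e : (n + 2 : ℝ) = a + 1 := by rw [ha]; ring
    have e2 : zetaTerm n s = ((s - 1) * (a : ℂ) ^ (-s) * ((a + 1 : ℝ) : ℂ) +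
        ((a + 1 : ℝ) : ℂ) ^ (1 - s)) -
        ((s - 1) * (a : ℂ) ^ (-s) * (a : ℂ) + (a : ℂ) ^ (1 - s)) := by
      rw [zetaTerm, e, ← ha]; push_cast; ring
    rw [e2]
    refine key.trans (le_of_eq ?_)
    ring
  · have hx0 : 0 < x := ha0.trans_le hx.1
    exact ((Complex.ofRealCLM.hasDerivAt.const_mul _).add
      (hasDerivAt_ofReal_cpow hx0 _)).hasDerivWithinAt
  · have h1 := norm_ofReal_cpow_sub_le (b := x) (C := a ^ (-s.re - 1)) ha0 hx.1 (-s) (fun y hy => by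
      rw [Complex.neg_re]
      exact Real.rpow_le_rpow_of_nonpos ha0 hy.1 (by linarith))
    have h2 : (s - 1) * (a : ℂ) ^ (-s) * 1 + (1 - s) * (x : ℂ) ^ (1 - s - 1) =
        -((s - 1) * ((x : ℂ) ^ (-s) - (a : ℂ) ^ (-s))) := by
      rw [show 1 - s - 1 = -s by ring]; ring
    rw [h2, norm_neg, norm_mul, mul_assoc]
    refine mul_le_mul_of_nonneg_left (h1.trans ?_) (norm_nonneg _)
    rw [norm_neg]
    have h3 : x - a ≤ 1 := by linarith [hx.2]
    exact mul_le_of_le_one_right (by positivity) h3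

lemma summable_rpow_succ {σ : ℝ} (hσ : 0 < σ) :
    Summable fun n : ℕ => (n + 1 : ℝ) ^ (-σ - 1) := by
  have := (summable_nat_add_iff 1).2 (Real.summable_nat_rpow (p := -σ - 1) |>.2 (by linarith))
  simpa using this

lemma norm_tsum_zetaTerm_le {σ : ℝ} (hσ : 0 < σ) {s : ℂ} (hs : σ ≤ s.re) :
    ‖∑' n, zetaTerm n s‖ ≤ ‖s - 1‖ * ‖s‖ * ∑' n : ℕ, (n + 1 : ℝ) ^ (-σ - 1) := by
  rw [← tsum_mul_left]
  refine tsum_of_norm_bounded ((summable_rpow_succ hσ).mul_left _).hasSum fun n => ?_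
  refine (norm_zetaTerm_le n (hσ.trans_le hs)).trans ?_
  gcongr
  linarith [(Nat.cast_nonneg n : (0 : ℝ) ≤ n)]

lemma differentiableAt_tsum_zetaTerm {s : ℂ} (hs : 0 < s.re) :
    DifferentiableAt ℂ (fun w => ∑' n, zetaTerm n w) s := by
  set U : Set ℂ := {w | s.re / 2 < w.re} ∩ Metric.ball 0 (‖s‖ + 1) with hU
  have hUo : IsOpen U :=
    (isOpen_lt continuous_const Complex.continuous_re).inter Metric.isOpen_ball
  have hsU : s ∈ U := ⟨by simpa using hs, by simp⟩
  refine (Complex.differentiableOn_tsum_of_summable_norm (F := zetaTerm)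
    ((summable_rpow_succ (half_pos hs)).mul_left ((‖s‖ + 1 + 1) * (‖s‖ + 1)))
    (fun n => ?_) hUo fun n w hw => ?_).differentiableAt (hUo.mem_nhds hsU)
  · have h1 : ((n + 1 : ℝ) : ℂ) ≠ 0 := Complex.ofReal_ne_zero.2 (by positivity)
    have h2 : ((n + 2 : ℝ) : ℂ) ≠ 0 := Complex.ofReal_ne_zero.2 (by positivity)
    have : Differentiable ℂ (zetaTerm n) := by
      unfold zetaTerm
      refine ((differentiable_id.sub_const 1).mul
        (differentiable_neg.const_cpow (Or.inl h1))).add ?_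
      exact ((differentiable_id.const_sub 1).const_cpow (Or.inl h2)).sub
        ((differentiable_id.const_sub 1).const_cpow (Or.inl h1))
    exact this.differentiableOn
  · have hw1 : s.re / 2 < w.re := hw.1
    have hw2 : ‖w‖ < ‖s‖ + 1 := by simpa using hw.2
    refine (norm_zetaTerm_le n ((half_pos hs).trans hw1)).trans ?_
    have hw3 : ‖w - 1‖ ≤ ‖s‖ + 1 + 1 := (norm_sub_le _ _).trans (by simp; linarith)
    gcongr
    linarith [(Nat.cast_nonneg n : (0 : ℝ) ≤ n)]

lemma zetaReg_eq_of_one_lt {s : ℂ} (hs : 1 < s.re) : zetaReg s = 1 + ∑' n, zetaTerm n s := by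
  have h1 : s ≠ 1 := by rintro rfl; simp at hs
  have hu : Summable fun n => zetaTerm n s :=
    .of_norm_bounded ((summable_rpow_succ (by linarith : 0 < s.re)).mul_left (‖s - 1‖ * ‖s‖))
      fun n => norm_zetaTerm_le n (by linarith)
  have hz : HasSum (fun n : ℕ => ((n + 1 : ℝ) : ℂ) ^ (-s)) (riemannZeta s) := by
    rw [zeta_eq_tsum_one_div_nat_add_one_cpow hs]
    have : Summable fun n : ℕ => 1 / (n + 1 : ℂ) ^ s := by
      simpa using (summable_nat_add_iff 1).2 (Complex.summable_one_div_nat_cpow.2 hs)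
    convert this.hasSum using 2 with n
    rw [Complex.cpow_neg, one_div]
    push_cast
    rfl
  have h2 := hu.hasSum.sub (hz.mul_left (s - 1))
  have h3 : (fun n : ℕ => zetaTerm n s - (s - 1) * ((n + 1 : ℝ) : ℂ) ^ (-s)) =
      fun n : ℕ => ((((n + 1 : ℕ) : ℝ) + 1 : ℝ) : ℂ) ^ (1 - s) -
        (((n : ℝ) + 1 : ℝ) : ℂ) ^ (1 - s) := by
    ext n
    rw [zetaTerm, add_sub_cancel_left,
      show (((n + 1 : ℕ) : ℝ) + 1) = (n : ℝ) + 2 by push_cast; ring]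
  rw [h3] at h2
  have h4 := h2.tendsto_sum_nat
  simp only [Finset.sum_range_sub (fun n : ℕ => (((n : ℝ) + 1 : ℝ) : ℂ) ^ (1 - s))] at h4
  have h5 : Tendsto (fun n : ℕ => (((n : ℝ) + 1 : ℝ) : ℂ) ^ (1 - s)) atTop (𝓝 0) := by
    rw [tendsto_zero_iff_norm_tendsto_zero]
    have : ∀ n : ℕ, ‖(((n : ℝ) + 1 : ℝ) : ℂ) ^ (1 - s)‖ = ((n : ℝ) + 1) ^ (-(s.re - 1)) := by
      intro n
      rw [Complex.norm_cpow_eq_rpow_re_of_pos (by positivity)]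
      simp
    simp only [this]
    exact (tendsto_rpow_neg_atTop (by linarith)).comp
      (tendsto_atTop_add_const_right _ _ tendsto_natCast_atTop_atTop)
  have h6 := tendsto_nhds_unique h4 (h5.sub_const _)
  simp at h6
  rw [zetaReg_of_ne h1]
  linear_combination -h6

lemma zetaReg_eq {s : ℂ} (hs : 0 < s.re) : zetaReg s = 1 + ∑' n, zetaTerm n s := by
  set U : Set ℂ := {w | 0 < w.re}
  have hUo : IsOpen U := isOpen_lt continuous_const Complex.continuous_re
  have hf : AnalyticOnNhd ℂ zetaReg U := differentiable_zetaReg.differentiableOn.analyticOnNhd hUo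
  have hg : AnalyticOnNhd ℂ (fun w => 1 + ∑' n, zetaTerm n w) U :=
    DifferentiableOn.analyticOnNhd (fun w hw =>
      ((differentiableAt_tsum_zetaTerm hw).const_add 1).differentiableWithinAt) hUo
  refine hf.eqOn_of_preconnected_of_eventuallyEq hg
    (convex_halfSpace_re_gt 0).isPreconnected (z₀ := 2) (by simp [U]) ?_ hs
  filter_upwards [(isOpen_lt continuous_const Complex.continuous_re).mem_nhds
    (show (2 : ℂ) ∈ {w : ℂ | 1 < w.re} by simp)] with w hw
  exact zetaReg_eq_of_one_lt hw

/-- Polynomial growth of `(s - 1) ζ(s)` in the half-plane `1/2 ≤ Re s`. -/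
lemma exists_norm_zetaReg_le :
    ∃ C : ℝ, 1 ≤ C ∧ ∀ s : ℂ, 1 / 2 ≤ s.re → ‖zetaReg s‖ ≤ C * (1 + ‖s‖) ^ 2 := by
  set S := ∑' n : ℕ, (n + 1 : ℝ) ^ (-(1 / 2 : ℝ) - 1)
  have hS : 0 ≤ S := tsum_nonneg fun n => by positivity
  refine ⟨1 + S, by linarith, fun s hs => ?_⟩
  rw [zetaReg_eq (by linarith)]
  have h1 : ‖∑' n, zetaTerm n s‖ ≤ ‖s - 1‖ * ‖s‖ * S :=
    norm_tsum_zetaTerm_le (by norm_num : (0 : ℝ) < 1 / 2) hs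
  have h2 : ‖s - 1‖ ≤ 1 + ‖s‖ := (norm_sub_le _ _).trans (by simp [add_comm])
  have h3 : ‖s - 1‖ * ‖s‖ ≤ (1 + ‖s‖) ^ 2 := by
    nlinarith [norm_nonneg s, norm_nonneg (s - 1), mul_le_mul_of_nonneg_right h2 (norm_nonneg s)]
  have h4 : ‖(1 : ℂ) + ∑' n, zetaTerm n s‖ ≤ 1 + ‖s - 1‖ * ‖s‖ * S :=
    (norm_add_le _ _).trans (by rw [norm_one]; linarith)
  have h5 := mul_le_mul_of_nonneg_right h3 hS
  nlinarith [norm_nonneg s]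

open Metric in
lemma norm_deriv_div_le {g : ℂ → ℂ} {c z : ℂ} {R r B : ℝ} (hg : DifferentiableOn ℂ g (ball c R))
    (h0 : ∀ w ∈ ball c R, g w ≠ 0) (hB : 1 < B) (hbd : ∀ w ∈ ball c R, ‖g w‖ ≤ B * ‖g c‖)
    (hrR : r < R) (hz : ‖z - c‖ ≤ r) :
    ‖deriv g z / g z‖ ≤ 4 * (R + r) / (R - r) ^ 2 * Real.log B := by
  have hr : 0 ≤ r := (norm_nonneg _).trans hz
  have hR : 0 < R := hr.trans_lt hrR
  have hM : 0 < Real.log B := Real.log_pos hB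
  have hc : c ∈ ball c R := mem_ball_self hR
  have hgd : ∀ w ∈ ball c R, HasDerivAt g (deriv g w) w := fun w hw =>
    (hg.differentiableAt (isOpen_ball.mem_nhds hw)).hasDerivAt
  have hq : DifferentiableOn ℂ (fun w => deriv g w / g w) (ball c R) :=
    (hg.deriv isOpen_ball).div hg h0
  obtain ⟨h, hhc, hh⟩ := hq.isExactOn_ball.with_val_at c 0
  have hconst : ∀ w ∈ ball c R, g w * Complex.exp (-h w) = g c := by
    intro w hw
    have hd : ∀ v ∈ ball c R, HasDerivAt (fun v => g v * Complex.exp (-h v)) 0 v := by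
      intro v hv
      refine ((hgd v hv).mul (hh v hv).fun_neg.cexp).congr_deriv ?_
      have e := div_mul_cancel₀ (deriv g v) (h0 v hv)
      linear_combination -Complex.exp (-h v) * e
    have := (convex_ball c R).is_const_of_fderivWithin_eq_zero (𝕜 := ℂ)
      (f := fun v => g v * Complex.exp (-h v))
      (fun v hv => (hd v hv).differentiableAt.differentiableWithinAt)
      (fun v hv => by
        rw [fderivWithin_of_isOpen isOpen_ball hv]
        have := (hd v hv).hasFDerivAt.fderiv
        simpa using this) hw hc
    simpa [hhc] using this
  have hre : ∀ w ∈ ball c R, (h w).re ≤ Real.log B := by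
    intro w hw
    have e : g w = g c * Complex.exp (h w) := by
      rw [← hconst w hw, mul_assoc, ← Complex.exp_add]; simp
    have h1 := hbd w hw
    rw [e, norm_mul, Complex.norm_exp, mul_comm] at h1
    exact (Real.le_log_iff_exp_le (by linarith)).2
      (le_of_mul_le_mul_right h1 (norm_pos_iff.2 (h0 c hc)))
  have hbc : ∀ w, ‖w - c‖ ≤ (R + r) / 2 → ‖h w‖ ≤ 2 * Real.log B * (R + r) / (R - r) := by
    intro w hw
    have hmem : ∀ v, v ∈ ball (0 : ℂ) R → v + c ∈ ball c R := fun v hv => by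
      simpa [mem_ball, dist_eq_norm] using hv
    have hwR : w - c ∈ ball (0 : ℂ) R := by
      rw [mem_ball_zero_iff]; linarith
    have h1 := Complex.borelCaratheodory_zero (f := fun v => h (v + c)) (R := R) hM
      (fun v hv => ((hh _ (hmem v hv)).comp_add_const v c).differentiableAt.differentiableWithinAt)
      (fun v hv => hre _ (hmem v hv)) hR hwR (by simpa using hhc)
    rw [sub_add_cancel] at h1
    refine h1.trans ?_
    have h2 : 0 < R - r := by linarith
    have h3 : 0 < R - ‖w - c‖ := by linarith
    rw [div_le_div_iff₀ h3 h2]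
    have h4 : ‖w - c‖ * (R - r) ≤ (R + r) * (R - ‖w - c‖) := by nlinarith
    nlinarith
  have hsub : closedBall z ((R - r) / 2) ⊆ ball c R := by
    intro w hw
    rw [mem_closedBall, dist_eq_norm] at hw
    rw [mem_ball, dist_eq_norm]
    have := norm_add_le (w - z) (z - c)
    rw [sub_add_sub_cancel] at this
    linarith
  have h5 := Complex.norm_deriv_le_of_forall_mem_sphere_norm_le (f := h) (c := z)
    (R := (R - r) / 2) (C := 2 * Real.log B * (R + r) / (R - r)) (by linarith)
    (DifferentiableOn.diffContOnCl_ball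
      (fun w hw => (hh w hw).differentiableAt.differentiableWithinAt) hsub)
    (fun w hw => hbc w (by
      rw [mem_sphere, dist_eq_norm] at hw
      have := norm_add_le (w - z) (z - c)
      rw [sub_add_sub_cancel] at this
      linarith))
  have hzm : z ∈ ball c R := by
    rw [mem_ball, dist_eq_norm]; linarith
  rw [(hh z hzm).deriv] at h5
  refine h5.trans (le_of_eq ?_)
  have h2 : R - r ≠ 0 := by linarith
  field_simp
  ring

lemma exists_le_norm_zeta_two_add :
    ∃ m : ℝ, 0 < m ∧ ∀ t : ℝ, m ≤ ‖zetaReg (2 + t * Complex.I)‖ := by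
  refine ⟨2 - Real.pi ^ 2 / 6, by nlinarith [Real.pi_lt_d2, Real.pi_pos], fun t => ?_⟩
  set s : ℂ := 2 + t * Complex.I with hs
  have hre : s.re = 2 := by simp [hs]
  have hs1 : s ≠ 1 := fun h => by rw [h] at hre; norm_num at hre
  have h1 : 1 ≤ ‖s - 1‖ := by
    have := Complex.abs_re_le_norm (s - 1)
    rw [Complex.sub_re, hre] at this
    norm_num at this
    linarith
  have h2 := (zeta_eq_tsum_one_div_nat_cpow (s := s) (by linarith))
  have hsum : Summable fun n : ℕ => 1 / (n : ℂ) ^ s :=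
    Complex.summable_one_div_nat_cpow.2 (by linarith)
  have hz := hasSum_zeta_two
  have h3 : ‖riemannZeta s - 1‖ ≤ Real.pi ^ 2 / 6 - 1 := by
    have e1 := hsum.hasSum
    rw [← h2] at e1
    have e2 := (hasSum_ite_eq (1 : ℕ) (1 : ℂ))
    have e3 := (hasSum_ite_eq (1 : ℕ) (1 : ℝ))
    rw [← (e1.sub e2).tsum_eq]
    refine tsum_of_norm_bounded (hz.sub e3) fun n => ?_
    rcases Nat.eq_zero_or_pos n with rfl | hn
    · have : s ≠ 0 := fun h => by rw [h] at hre; norm_num at hre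
      simp [this]
    · split_ifs with h
      · subst h; simp
      · rw [sub_zero, sub_zero, norm_div, norm_one, Complex.norm_natCast_cpow_of_pos hn, hre]
        norm_num
  have h4 : 2 - Real.pi ^ 2 / 6 ≤ ‖riemannZeta s‖ := by
    have := norm_sub_norm_le (1 : ℂ) (riemannZeta s)
    rw [norm_one, norm_sub_rev] at this
    linarith
  rw [zetaReg_of_ne hs1, norm_mul]
  nlinarith [norm_nonneg (riemannZeta s)]

lemma exists_norm_deriv_zetaReg_div_le (hRH : RiemannHypothesis') {a η : ℝ} (ha : 1 / 2 < a)
    (hη : 0 < η) :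
    ∃ C : ℝ, 0 < C ∧ ∀ s : ℂ, a ≤ s.re → s.re ≤ 2 →
      ‖deriv zetaReg s / zetaReg s‖ ≤ C * (1 + |s.im|) ^ η := by
  obtain ⟨C, hC1, hC⟩ := exists_norm_zetaReg_le
  obtain ⟨m, hm, hml⟩ := exists_le_norm_zeta_two_add
  set b := min a 1 with hb
  have hb2 : 1 / 2 < b := lt_min ha (by norm_num)
  have hb1 : b ≤ 1 := min_le_right ..
  set D : ℝ := 1 + C * 25 / m with hD
  have hD1 : 1 < D := by rw [hD]; have : 0 < C * 25 / m := by positivity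
                         linarith
  set K : ℝ := 4 * (3 / 2 + (2 - b)) / (3 / 2 - (2 - b)) ^ 2 with hK
  have hK0 : 0 < K := by
    rw [hK]
    have : 0 < 3 / 2 - (2 - b) := by linarith
    have : 0 < 3 / 2 + (2 - b) := by linarith
    positivity
  refine ⟨K * (Real.log D + 2 / η), by have := Real.log_pos hD1; positivity, fun s h1 h2 => ?_⟩
  set t := s.im
  set u : ℝ := 1 + |t| with hu
  have hu1 : 1 ≤ u := by rw [hu]; linarith [abs_nonneg t]
  have key := norm_deriv_div_le (g := zetaReg) (c := 2 + t * Complex.I) (z := s) (R := 3 / 2)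
    (r := 2 - b) (B := D * u ^ 2) differentiable_zetaReg.differentiableOn ?_ ?_ ?_ ?_ ?_
  · refine key.trans ?_
    rw [← hK, mul_assoc]
    refine mul_le_mul_of_nonneg_left ?_ hK0.le
    rw [Real.log_mul (by positivity) (by positivity), Real.log_pow]
    have h3 := Real.log_le_rpow_div (x := u) (by linarith) hη
    have h4 : 1 ≤ u ^ η := Real.one_le_rpow hu1 hη.le
    have h5 := Real.log_pos hD1
    have h6 : u ^ η / η = 1 / η * u ^ η := by ring
    have h7 : (2 : ℝ) / η * u ^ η = 2 * (1 / η * u ^ η) := by ring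
    push_cast
    rw [h6] at h3
    rw [add_mul, h7]
    nlinarith
  · intro w hw
    refine zetaReg_ne_zero hRH ?_
    rw [Metric.mem_ball, dist_eq_norm] at hw
    have := (Complex.abs_re_le_norm _).trans_lt hw
    simp at this
    linarith [(abs_lt.1 this).1]
  · exact one_lt_mul_of_lt_of_le hD1 (one_le_pow₀ hu1)
  · intro w hw
    rw [Metric.mem_ball, dist_eq_norm] at hw
    have h3 := (Complex.abs_re_le_norm _).trans_lt hw
    simp at h3
    have h4 : ‖w‖ ≤ 4 * u := by
      have e1 : ‖w‖ ≤ ‖w - (2 + t * Complex.I)‖ + ‖2 + t * Complex.I‖ := by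
        simpa using norm_add_le (w - (2 + t * Complex.I)) (2 + t * Complex.I)
      have e2 : ‖2 + t * Complex.I‖ ≤ 2 + |t| := by
        refine (norm_add_le _ _).trans (by simp)
      rw [hu]
      linarith [abs_nonneg t]
    have h5 : ‖zetaReg w‖ ≤ C * (1 + ‖w‖) ^ 2 := hC w (by linarith [(abs_lt.1 h3).1])
    have h6 : C * (1 + ‖w‖) ^ 2 ≤ C * (5 * u) ^ 2 := by
      gcongr
      linarith
    calc ‖zetaReg w‖ ≤ C * (5 * u) ^ 2 := h5.trans h6
      _ = C * 25 / m * u ^ 2 * m := by field_simp; ring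
      _ ≤ D * u ^ 2 * ‖zetaReg (2 + t * Complex.I)‖ := by
        gcongr
        · rw [hD]; linarith
        · exact hml t
  · linarith
  · have e : s - (2 + t * Complex.I) = ((s.re - 2 : ℝ) : ℂ) := by
      apply Complex.ext <;> simp [t]
    rw [e, Complex.norm_real, Real.norm_eq_abs, abs_of_nonpos (by linarith)]
    have := min_le_left a 1
    linarith

lemma one_add_abs_im_le {s : ℂ} (hs : 1 / 2 ≤ s.re) : (1 + |s.im|) / 3 ≤ ‖s‖ := by
  have h1 := Complex.abs_re_le_norm s
  have h2 := Complex.abs_im_le_norm s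
  rw [abs_of_nonneg (by linarith)] at h1
  linarith

lemma norm_one_div_mul_add_one_le {s : ℂ} (hs : 1 / 2 ≤ s.re) :
    ‖1 / (s * (s + 1))‖ ≤ 9 * (1 + |s.im|) ^ (-2 : ℝ) := by
  have h1 := one_add_abs_im_le hs
  have h2 := one_add_abs_im_le (s := s + 1) (by simp; linarith)
  simp only [Complex.add_im, Complex.one_im, add_zero] at h2
  have h3 : 0 < (1 + |s.im|) / 3 := by positivity
  rw [Real.rpow_neg (by positivity), norm_div, norm_one, norm_mul, ← div_eq_mul_inv,
    div_le_div_iff₀ (mul_pos (h3.trans_le h1) (h3.trans_le h2)) (by positivity)]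
  have := mul_le_mul h1 h2 h3.le (h3.le.trans h1)
  norm_num
  linarith

lemma integrable_one_add_abs_rpow {p : ℝ} (hp : 1 < p) :
    MeasureTheory.Integrable fun t : ℝ => (1 + |t|) ^ (-p) := by
  have := integrable_one_add_norm (E := ℝ) (μ := MeasureTheory.volume) (r := p) (by simpa using hp)
  simpa using this

lemma mellinInv_eq_of_hasMellin {σ : ℝ} {f g : ℝ → ℂ} {F : ℂ → ℂ} (hfg : Set.EqOn f g (Set.Ioi 0))
    (h : ∀ t : ℝ, HasMellin f (σ + t * Complex.I) (F (σ + t * Complex.I)))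
    (hF : Complex.VerticalIntegrable F σ) {x : ℝ} (hx : 0 < x) (hg : ContinuousAt g x) :
    mellinInv σ F x = g x := by
  rw [← hfg hx]
  have hfx : ContinuousAt f x := hg.congr (hfg.symm.eventuallyEq_of_mem (Ioi_mem_nhds hx))
  have e : ∀ t : ℝ, F (σ + t * Complex.I) = mellin f (σ + t * Complex.I) := fun t => (h t).2.symm
  rw [← mellinInv_mellin_eq σ f hx (by simpa using (h 0).1) ?_ hfx]
  · simp only [mellinInv, e]
  · refine hF.congr (Filter.Eventually.of_forall fun t => ?_)
    exact e t

lemma verticalIntegrable_one_div_mul_add_one {σ : ℝ} (hσ : 1 / 2 ≤ σ) :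
    Complex.VerticalIntegrable (fun s => 1 / (s * (s + 1))) σ := by
  refine ((integrable_one_add_abs_rpow (p := 2) (by norm_num)).const_mul 9).mono' ?_
    (Filter.Eventually.of_forall fun t => ?_)
  · refine Continuous.aestronglyMeasurable ?_
    refine Continuous.div₀ continuous_const (by fun_prop) fun t h => ?_
    rcases mul_eq_zero.1 h with h | h
    · have := congrArg Complex.re h
      simp at this
      linarith
    · have := congrArg Complex.re h
      simp at this
      linarith
  · have := norm_one_div_mul_add_one_le (s := σ + t * Complex.I) (by simpa using hσ)
    simpa using this

lemma mellinInv_one_div_mul_add_one {v : ℝ} (hv : 0 < v) :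
    mellinInv 2 (fun s => 1 / (s * (s + 1))) v = ((max (1 - v) 0 : ℝ) : ℂ) := by
  have hcont : Set.EqOn (fun t : ℝ => (Set.Ioc 0 1).indicator (fun _ => 1 : ℝ → ℂ) t -
      (Set.Ioc 0 1).indicator (fun t => (t : ℂ) ^ (1 : ℂ) : ℝ → ℂ) t)
      (fun t => ((max (1 - t) 0 : ℝ) : ℂ)) (Set.Ioi 0) := by
    intro t ht
    rcases le_or_gt t 1 with h | h
    · have : t ∈ Set.Ioc (0 : ℝ) 1 := ⟨ht, h⟩
      simp [this, h]
    · have : t ∉ Set.Ioc (0 : ℝ) 1 := fun h' => absurd h'.2 (not_le.2 h)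
      simp [this, h.le]
  refine mellinInv_eq_of_hasMellin hcont (fun t => ?_)
    (verticalIntegrable_one_div_mul_add_one (by norm_num)) hv
    (Continuous.continuousAt (by fun_prop))
  · set s : ℂ := ((2 : ℝ) : ℂ) + t * Complex.I with hs
    have hre : s.re = 2 := by simp [hs]
    have h1 := hasMellin_one_Ioc (s := s) (by linarith)
    have h2 := hasMellin_cpow_Ioc 1 (s := s) (by norm_num [hre])
    have h3 := hasMellin_sub h1.1 h2.1
    rw [h1.2, h2.2] at h3
    have hs0 : s ≠ 0 := fun h => by simp [h] at hre
    have hs1 : s + 1 ≠ 0 := fun h => by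
      have := congrArg Complex.re h
      simp [hre] at this
      norm_num at this
    have e : 1 / (s * (s + 1)) = 1 / s - 1 / (s + 1) := by
      field_simp
      ring
    simpa only [e] using h3

lemma verticalIntegrable_one_div_sub_one_mul :
    Complex.VerticalIntegrable (fun s => 1 / ((s - 1) * (s * (s + 1)))) 2 := by
  refine (verticalIntegrable_one_div_mul_add_one (σ := 2) (by norm_num)).mono ?_
    (Filter.Eventually.of_forall fun t => ?_)
  · refine Continuous.aestronglyMeasurable ?_
    refine Continuous.div₀ continuous_const (by fun_prop) fun t h => ?_
    rcases mul_eq_zero.1 h with h | h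
    · have := congrArg Complex.re h
      norm_num at this
    rcases mul_eq_zero.1 h with h | h
    · have := congrArg Complex.re h
      norm_num at this
    · have := congrArg Complex.re h
      norm_num at this
  · simp only
    rw [← div_div, div_right_comm, norm_div _ (_ - 1 : ℂ)]
    refine div_le_self (norm_nonneg _) ?_
    refine le_trans ?_ (Complex.abs_re_le_norm _)
    norm_num

lemma mellinInv_one_div_sub_one_mul {v : ℝ} (hv : 0 < v) (hv1 : v ≤ 1) :
    mellinInv 2 (fun s => 1 / ((s - 1) * (s * (s + 1)))) v =
      (((1 - v) ^ 2 / (2 * v) : ℝ) : ℂ) := by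
  have hcont : Set.EqOn (fun t : ℝ => (1 / 2 : ℂ) •
      ((Set.Ioc 0 1).indicator (fun t => (t : ℂ) ^ (-1 : ℂ) : ℝ → ℂ) t -
      ((2 : ℂ) • (Set.Ioc 0 1).indicator (fun _ => 1 : ℝ → ℂ) t -
      (Set.Ioc 0 1).indicator (fun t => (t : ℂ) ^ (1 : ℂ) : ℝ → ℂ) t)))
      (fun t => (((max (1 - t) 0) ^ 2 / (2 * t) : ℝ) : ℂ)) (Set.Ioi 0) := by
    intro t ht
    rcases le_or_gt t 1 with h | h
    · have h1 : t ∈ Set.Ioc (0 : ℝ) 1 := ⟨ht, h⟩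
      have h2 : (t : ℂ) ≠ 0 := Complex.ofReal_ne_zero.2 (ne_of_gt ht)
      simp [h1, h, Complex.cpow_neg]
      field_simp
      ring
    · have : t ∉ Set.Ioc (0 : ℝ) 1 := fun h' => absurd h'.2 (not_le.2 h)
      simp [this, h.le]
  refine (mellinInv_eq_of_hasMellin hcont (fun t => ?_)
    verticalIntegrable_one_div_sub_one_mul hv ?_).trans ?_
  · set s : ℂ := ((2 : ℝ) : ℂ) + t * Complex.I with hs
    have hre : s.re = 2 := by simp [hs]
    have h1 := hasMellin_one_Ioc (s := s) (by linarith)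
    have h2 := hasMellin_cpow_Ioc 1 (s := s) (by norm_num [hre])
    have h0 := hasMellin_cpow_Ioc (-1) (s := s) (by simp [hre])
    have h3 := hasMellin_const_smul h1.1 (2 : ℂ)
    have h4 := hasMellin_sub h3.1 h2.1
    have h5 := hasMellin_sub h0.1 h4.1
    have h6 := hasMellin_const_smul h5.1 (1 / 2 : ℂ)
    rw [h5.2, h4.2, h3.2, h0.2, h1.2, h2.2] at h6
    have hs0 : s ≠ 0 := fun h => by simp [h] at hre
    have hs1 : s + 1 ≠ 0 := fun h => by
      have := congrArg Complex.re h
      simp [hre] at this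
      norm_num at this
    have hs2 : s - 1 ≠ 0 := fun h => by
      have := congrArg Complex.re h
      simp [hre] at this
      norm_num at this
    have e : 1 / ((s - 1) * (s * (s + 1))) =
        (1 / 2 : ℂ) • (1 / (s + -1) - ((2 : ℂ) • (1 / s) - 1 / (s + 1))) := by
      rw [← sub_eq_add_neg, smul_eq_mul, smul_eq_mul]
      field_simp
      ring
    simpa only [e] using h6
  · refine Complex.continuous_ofReal.continuousAt.comp ?_
    exact ContinuousAt.div (by fun_prop) (by fun_prop) (by positivity)
  · simp [hv1]

lemma hasSum_vonMangoldt_mul_max {x : ℝ} (hx : 0 < x) :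
    HasSum (fun n : ℕ => ((ArithmeticFunction.vonMangoldt n * max (1 - n / x) 0 : ℝ) : ℂ))
      (1 / (2 * Real.pi) * ∫ t : ℝ, (x : ℂ) ^ (2 + t * Complex.I) *
        (-deriv riemannZeta (2 + t * Complex.I) / riemannZeta (2 + t * Complex.I)) *
        (1 / ((2 + t * Complex.I) * (2 + t * Complex.I + 1)))) := by
  have hre : ∀ t : ℝ, (2 + t * Complex.I).re = 2 := fun t => by simp
  set F : ℕ → ℝ → ℂ := fun n t => LSeries.term (fun n => (ArithmeticFunction.vonMangoldt n : ℂ))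
    (2 + t * Complex.I) n * (x : ℂ) ^ (2 + t * Complex.I) *
      (1 / ((2 + t * Complex.I) * (2 + t * Complex.I + 1))) with hF
  have hv : MeasureTheory.Integrable fun t : ℝ =>
      1 / ((2 + t * Complex.I) * (2 + t * Complex.I + 1)) := by
    simpa [Complex.VerticalIntegrable] using
      verticalIntegrable_one_div_mul_add_one (σ := 2) (by norm_num)
  have hterm : ∀ (n : ℕ) (t : ℝ), F n t = (ArithmeticFunction.vonMangoldt n : ℂ) *
      (((n / x : ℝ) : ℂ) ^ (-(2 + t * Complex.I)) *
        (1 / ((2 + t * Complex.I) * (2 + t * Complex.I + 1)))) := by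
    intro n t
    rcases Nat.eq_zero_or_pos n with rfl | hn
    · simp [hF]
    · rw [hF]
      simp only
      rw [LSeries.term_of_ne_zero hn.ne']
      have hn0 : ((n : ℝ) : ℂ) ^ (2 + t * Complex.I) ≠ 0 := by
        rw [Ne, Complex.cpow_eq_zero_iff]
        simp [hn.ne']
      have e : ((n : ℝ) : ℂ) ^ (2 + t * Complex.I) =
          ((n / x : ℝ) : ℂ) ^ (2 + t * Complex.I) * (x : ℂ) ^ (2 + t * Complex.I) := by
        rw [← Complex.mul_cpow_ofReal_nonneg (by positivity) hx.le, ← Complex.ofReal_mul,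
          div_mul_cancel₀ _ hx.ne']
      have hx0 : (x : ℂ) ^ (2 + t * Complex.I) ≠ 0 := by
        rw [Ne, Complex.cpow_eq_zero_iff]
        simp [hx.ne']
      have e2 : ((n / x : ℝ) : ℂ) ^ (2 + t * Complex.I) ≠ 0 := by
        intro h
        exact hn0 (by rw [e, h, zero_mul])
      rw [← Complex.ofReal_natCast, e, Complex.cpow_neg]
      field_simp
  have hnorm : ∀ (n : ℕ) (t : ℝ), ‖F n t‖ =
      ‖LSeries.term (fun n => (ArithmeticFunction.vonMangoldt n : ℂ)) 2 n‖ *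
        (x ^ 2 * ‖1 / ((2 + t * Complex.I) * (2 + t * Complex.I + 1))‖) := by
    intro n t
    rw [hF]
    simp only [norm_mul]
    rw [Complex.norm_cpow_eq_rpow_re_of_pos hx, hre, LSeries.norm_term_eq,
      LSeries.norm_term_eq, hre,
      Complex.re_ofNat, Real.rpow_two, mul_assoc]
    congr!
    exact Real.rpow_two x
  have hint : ∀ n, MeasureTheory.Integrable (F n) := by
    intro n
    refine (hv.const_mul (ArithmeticFunction.vonMangoldt n * (x / n) ^ 2)).mono ?_
      (Filter.Eventually.of_forall fun t => ?_)
    · rcases Nat.eq_zero_or_pos n with rfl | hn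
      · simpa [hF] using MeasureTheory.aestronglyMeasurable_const
      · have : F n = fun t : ℝ => (ArithmeticFunction.vonMangoldt n : ℂ) *
          (((n / x : ℝ) : ℂ) ^ (-(2 + t * Complex.I)) *
          (1 / ((2 + t * Complex.I) * (2 + t * Complex.I + 1)))) := funext (hterm n)
        rw [this]
        have hnx : ((n / x : ℝ) : ℂ) ≠ 0 := Complex.ofReal_ne_zero.2 (by positivity)
        refine (MeasureTheory.AEStronglyMeasurable.mul ?_ hv.1).const_mul _
        refine Continuous.aestronglyMeasurable ?_
        exact Continuous.const_cpow (by fun_prop) (Or.inl hnx)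
    · rw [hnorm, LSeries.norm_term_eq]
      rcases Nat.eq_zero_or_pos n with rfl | hn
      · simp
      · rw [if_neg hn.ne', norm_mul, norm_mul, Complex.norm_real]
        norm_num
        rw [abs_of_pos hx]
        apply le_of_eq
        ring
  have hsum := MeasureTheory.hasSum_integral_of_summable_integral_norm hint (by
    simp only [hnorm, MeasureTheory.integral_const_mul]
    exact (ArithmeticFunction.LSeriesSummable_vonMangoldt (s := 2) (by norm_num)).norm.mul_right _)
  have htsum : ∀ t : ℝ, ∑' n, F n t = (x : ℂ) ^ (2 + t * Complex.I) *
        (-deriv riemannZeta (2 + t * Complex.I) / riemannZeta (2 + t * Complex.I)) *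
        (1 / ((2 + t * Complex.I) * (2 + t * Complex.I + 1))) := by
    intro t
    rw [← ArithmeticFunction.LSeries_vonMangoldt_eq_deriv_riemannZeta_div (by simp), LSeries, hF]
    simp only [mul_assoc]
    rw [tsum_mul_right]
    exact mul_left_comm _ _ _
  simp only [htsum] at hsum
  have h2 := hsum.mul_left (1 / (2 * (Real.pi : ℂ)))
  have h3 : ∀ n : ℕ, ((ArithmeticFunction.vonMangoldt n * max (1 - n / x) 0 : ℝ) : ℂ) =
      1 / (2 * (Real.pi : ℂ)) * ∫ t, F n t := by
    intro n
    rcases Nat.eq_zero_or_pos n with rfl | hn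
    · simp [hterm]
    have h3 := mellinInv_one_div_mul_add_one (v := n / x) (by positivity)
    rw [Complex.ofReal_mul, ← h3, mellinInv]
    simp only [hterm, MeasureTheory.integral_const_mul, smul_eq_mul, Complex.real_smul]
    push_cast
    ring
  simpa only [h3] using h2

lemma integrable_vertical_of_norm_le {f : ℂ → ℂ} {σ C p : ℝ} (hp : 1 < p)
    (hd : ∀ s : ℂ, s.re = σ → DifferentiableAt ℂ f s)
    (hC : ∀ s : ℂ, s.re = σ → ‖f s‖ ≤ C * (1 + |s.im|) ^ (-p)) :
    MeasureTheory.Integrable fun t : ℝ => f (σ + t * Complex.I) := by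
  refine ((integrable_one_add_abs_rpow hp).const_mul C).mono' ?_
    (Filter.Eventually.of_forall fun t => ?_)
  · refine Continuous.aestronglyMeasurable (continuous_iff_continuousAt.2 fun t => ?_)
    exact ContinuousAt.comp (f := fun t : ℝ => (σ + t * Complex.I : ℂ))
      (hd _ (by simp)).continuousAt (by fun_prop)
  · simpa using hC (σ + t * Complex.I) (by simp)

lemma integral_vertical_eq {f : ℂ → ℂ} {a b C p : ℝ} (hab : a ≤ b) (hp : 1 < p)
    (hd : ∀ s : ℂ, a ≤ s.re → s.re ≤ b → DifferentiableAt ℂ f s)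
    (hC : ∀ s : ℂ, a ≤ s.re → s.re ≤ b → ‖f s‖ ≤ C * (1 + |s.im|) ^ (-p)) :
    ∫ t : ℝ, f (b + t * Complex.I) = ∫ t : ℝ, f (a + t * Complex.I) := by
  have hint : ∀ σ : ℝ, a ≤ σ → σ ≤ b → Tendsto (fun T : ℝ => ∫ t in -T..T, f (σ + t * Complex.I))
      atTop (𝓝 (∫ t : ℝ, f (σ + t * Complex.I))) := fun σ h1 h2 =>
    MeasureTheory.intervalIntegral_tendsto_integral
      (integrable_vertical_of_norm_le hp (fun s hs => hd s (by rwa [hs]) (by rwa [hs]))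
        fun s hs => hC s (by rwa [hs]) (by rwa [hs])) tendsto_neg_atTop_atBot tendsto_id
  have hdec : Tendsto (fun T : ℝ => C * (1 + T) ^ (-p) * |b - a|) atTop (𝓝 0) := by
    have h1 : Tendsto (fun T : ℝ => (1 + T) ^ (-p)) atTop (𝓝 0) :=
      (tendsto_rpow_neg_atTop (by linarith)).comp (tendsto_atTop_add_const_left _ _ tendsto_id)
    simpa using (h1.const_mul C).mul_const |b - a|
  have hhor : ∀ T y : ℝ, 0 ≤ T → |y| = T →
      ‖∫ x in a..b, f (x + y * Complex.I)‖ ≤ C * (1 + T) ^ (-p) * |b - a| := by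
    intro T y hT hy
    refine intervalIntegral.norm_integral_le_of_norm_le_const fun x hx => ?_
    rw [Set.uIoc_of_le hab] at hx
    have := hC (x + y * Complex.I) (by simpa using hx.1.le) (by simpa using hx.2)
    simpa [hy] using this
  have hzero : Tendsto (fun T : ℝ => (∫ t in -T..T, f (b + t * Complex.I)) -
      ∫ t in -T..T, f (a + t * Complex.I)) atTop (𝓝 0) := by
    refine squeeze_zero_norm' ?_ (by simpa using hdec.add hdec)
    filter_upwards [eventually_ge_atTop 0] with T hT
    have h := Complex.integral_boundary_rect_eq_zero_of_differentiableOn f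
      (a + (-T : ℝ) * Complex.I) (b + T * Complex.I) (fun s hs => by
        have h1 := hs.1
        simp only [Set.mem_preimage, Complex.add_re, Complex.ofReal_re, Complex.mul_re,
          Complex.I_re, mul_zero, Complex.ofReal_im, Complex.I_im, mul_one, sub_self, add_zero,
          Set.uIcc_of_le hab] at h1
        exact (hd s h1.1 h1.2).differentiableWithinAt)
    simp only [Complex.add_re, Complex.ofReal_re, Complex.mul_re, Complex.I_re, mul_zero,
      Complex.ofReal_im, Complex.I_im, mul_one, sub_self, add_zero, Complex.add_im,
      Complex.mul_im, zero_add, smul_eq_mul] at h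
    have e : (∫ t in -T..T, f (b + t * Complex.I)) - ∫ t in -T..T, f (a + t * Complex.I) =
        Complex.I * ((∫ x in a..b, f (x + (-T : ℝ) * Complex.I)) -
          ∫ x in a..b, f (x + T * Complex.I)) := by
      linear_combination (-Complex.I) * h + ((∫ t in -T..T, f (b + t * Complex.I)) -
        ∫ t in -T..T, f (a + t * Complex.I)) * Complex.I_sq
    rw [e, norm_mul, Complex.norm_I, one_mul]
    refine (norm_sub_le _ _).trans (add_le_add ?_ ?_)
    · exact hhor T (-T) hT (by rw [abs_neg, abs_of_nonneg hT])
    · exact hhor T T hT (abs_of_nonneg hT)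
  have := tendsto_nhds_unique ((hint b hab le_rfl).sub (hint a le_rfl hab)) hzero
  exact sub_eq_zero.1 this

/-- Minus the logarithmic derivative of `(s - 1) ζ(s)`. -/
noncomputable def zetaLogDeriv (s : ℂ) : ℂ := -(deriv zetaReg s / zetaReg s)

lemma neg_deriv_zeta_div_eq {s : ℂ} (hs : 1 < s.re) :
    -deriv riemannZeta s / riemannZeta s = zetaLogDeriv s + 1 / (s - 1) := by
  have h1 : s ≠ 1 := by rintro rfl; simp at hs
  have hz : riemannZeta s ≠ 0 := riemannZeta_ne_zero_of_one_le_re hs.le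
  have hs1 : s - 1 ≠ 0 := sub_ne_zero.2 h1
  have e : zetaReg =ᶠ[𝓝 s] fun w => (w - 1) * riemannZeta w := by
    filter_upwards [isOpen_ne.mem_nhds h1] with w hw
    exact zetaReg_of_ne hw
  have hd : deriv zetaReg s = riemannZeta s + (s - 1) * deriv riemannZeta s := by
    rw [e.deriv_eq]
    have := ((hasDerivAt_id s).sub_const 1).fun_mul (differentiableAt_riemannZeta h1).hasDerivAt
    simpa using this.deriv
  rw [zetaLogDeriv, hd, zetaReg_of_ne h1]
  field_simp
  ring

lemma differentiableAt_zetaLogDeriv (hRH : RiemannHypothesis') {s : ℂ} (hs : 1 / 2 < s.re) :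
    DifferentiableAt ℂ zetaLogDeriv s := by
  have h1 : DifferentiableAt ℂ (deriv zetaReg) s :=
    (differentiable_zetaReg.contDiff (n := 2)).differentiable_deriv_two s
  exact (h1.div (differentiable_zetaReg s) (zetaReg_ne_zero hRH hs)).neg

lemma exists_norm_zetaLogDeriv_le (hRH : RiemannHypothesis') {a η : ℝ} (ha : 1 / 2 < a)
    (hη : 0 < η) :
    ∃ C : ℝ, 0 < C ∧ ∀ s : ℂ, a ≤ s.re → s.re ≤ 2 →
      ‖zetaLogDeriv s * (1 / (s * (s + 1)))‖ ≤ C * (1 + |s.im|) ^ (η - 2) := by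
  obtain ⟨C, hC, h⟩ := exists_norm_deriv_zetaReg_div_le hRH ha hη
  refine ⟨C * 9, by positivity, fun s h1 h2 => ?_⟩
  have h3 := h s h1 h2
  have h4 := norm_one_div_mul_add_one_le (s := s) (by linarith)
  rw [norm_mul, zetaLogDeriv, norm_neg, sub_eq_add_neg, Real.rpow_add (by positivity)]
  calc _ ≤ C * (1 + |s.im|) ^ η * (9 * (1 + |s.im|) ^ (-2 : ℝ)) := by gcongr
    _ = _ := by ring

lemma differentiableAt_zetaLogDeriv_mul (hRH : RiemannHypothesis') {s : ℂ} (hs : 1 / 2 < s.re) :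
    DifferentiableAt ℂ (fun s => zetaLogDeriv s * (1 / (s * (s + 1)))) s := by
  refine (differentiableAt_zetaLogDeriv hRH hs).mul
    ((differentiableAt_const _).div (by fun_prop) (mul_ne_zero ?_ ?_))
  · rintro rfl
    norm_num at hs
  · intro h
    have := congrArg Complex.re h
    simp at this
    linarith

/-- The explicit formula for the Cesàro mean of the von Mangoldt function, on any line to the
right of the zeros. -/
lemma hasSum_vonMangoldt_mul_max_eq (hRH : RiemannHypothesis') {a x : ℝ} (ha : 1 / 2 < a)
    (ha2 : a ≤ 2) (hx : 1 ≤ x) :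
    HasSum (fun n : ℕ => ((ArithmeticFunction.vonMangoldt n * max (1 - n / x) 0 : ℝ) : ℂ))
      (((x - 1) ^ 2 / (2 * x) : ℝ) + 1 / (2 * Real.pi) * ∫ t : ℝ, (x : ℂ) ^ (a + t * Complex.I) *
        (zetaLogDeriv (a + t * Complex.I) *
        (1 / ((a + t * Complex.I) * (a + t * Complex.I + 1))))) := by
  have hx0 : 0 < x := by linarith
  have hxc : (x : ℂ) ≠ 0 := Complex.ofReal_ne_zero.2 hx0.ne'
  obtain ⟨C, hC0, hC⟩ := exists_norm_zetaLogDeriv_le hRH ha (η := 1 / 2) (by norm_num)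
  have hd : ∀ s : ℂ, a ≤ s.re → s.re ≤ 2 → DifferentiableAt ℂ (fun s : ℂ => (x : ℂ) ^ s *
      (zetaLogDeriv s * (1 / (s * (s + 1))))) s := fun s h1 _ =>
    (differentiableAt_id.const_cpow (Or.inl hxc)).mul
      (differentiableAt_zetaLogDeriv_mul hRH (ha.trans_le h1))
  have hb : ∀ s : ℂ, a ≤ s.re → s.re ≤ 2 → ‖(x : ℂ) ^ s *
      (zetaLogDeriv s * (1 / (s * (s + 1))))‖ ≤
        x ^ (2 : ℝ) * C * (1 + |s.im|) ^ (-(3 / 2) : ℝ) := by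
    intro s h1 h2
    rw [norm_mul, Complex.norm_cpow_eq_rpow_re_of_pos hx0, mul_assoc]
    refine mul_le_mul (Real.rpow_le_rpow_of_exponent_le hx h2) ?_ (norm_nonneg _) (by positivity)
    have := hC s h1 h2
    norm_num at this ⊢
    exact this
  rw [← integral_vertical_eq ha2 (by norm_num) hd hb]
  have hI1 := integrable_vertical_of_norm_le (σ := 2) (p := 3 / 2) (by norm_num)
    (fun s hs => hd s (by linarith) hs.le) (fun s hs => hb s (by linarith) hs.le)
  have h2 := mellinInv_one_div_sub_one_mul (v := 1 / x) (by positivity)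
    (by rw [div_le_one hx0]; exact hx)
  have hI2 : MeasureTheory.Integrable fun t : ℝ => (x : ℂ) ^ (2 + t * Complex.I) *
      (1 / ((2 + t * Complex.I - 1) * ((2 + t * Complex.I) * (2 + t * Complex.I + 1)))) := by
    have h := verticalIntegrable_one_div_sub_one_mul
    simp only [Complex.VerticalIntegrable, Complex.ofReal_ofNat] at h
    refine (h.const_mul (x ^ 2 : ℂ)).mono (MeasureTheory.AEStronglyMeasurable.mul ?_ h.1)
      (Filter.Eventually.of_forall fun t => ?_)
    · refine Continuous.aestronglyMeasurable ?_
      exact Continuous.const_cpow (by fun_prop) (Or.inl hxc)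
    · rw [norm_mul, norm_mul, Complex.norm_cpow_eq_rpow_re_of_pos hx0]
      simp [abs_of_pos hx0]
  have h3 : ((((x - 1) ^ 2 / (2 * x) : ℝ)) : ℂ) = 1 / (2 * Real.pi) * ∫ t : ℝ,
      (x : ℂ) ^ (2 + t * Complex.I) *
        (1 / ((2 + t * Complex.I - 1) * ((2 + t * Complex.I) * (2 + t * Complex.I + 1)))) := by
    have e : (x - 1) ^ 2 / (2 * x) = (1 - 1 / x) ^ 2 / (2 * (1 / x)) := by
      field_simp
    rw [e, ← h2, mellinInv]
    have e2 : ∀ s : ℂ, ((1 / x : ℝ) : ℂ) ^ (-s) = (x : ℂ) ^ s := by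
      intro s
      rw [one_div, Complex.ofReal_inv, Complex.inv_cpow_ofReal_nonneg hx0.le, Complex.cpow_neg,
        inv_inv]
    simp only [e2, smul_eq_mul, Complex.real_smul]
    push_cast
    rfl
  simp only [Complex.ofReal_ofNat] at hI1 ⊢
  rw [h3, ← mul_add, ← MeasureTheory.integral_add hI2 hI1]
  convert hasSum_vonMangoldt_mul_max hx0 using 2
  refine MeasureTheory.integral_congr_ae (Filter.Eventually.of_forall fun t => ?_)
  simp only
  rw [neg_deriv_zeta_div_eq (by simp), ← one_div_mul_one_div (2 + t * Complex.I - 1)]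
  ring

/-- The error term in the explicit formula, as an integral over the line `Re s = a`. -/
noncomputable def cesaroError (a x : ℝ) : ℂ :=
  1 / (2 * Real.pi) * ∫ t : ℝ, (x : ℂ) ^ (a + t * Complex.I + 1) *
    (zetaLogDeriv (a + t * Complex.I) * (1 / ((a + t * Complex.I) * (a + t * Complex.I + 1))))

lemma norm_ofReal_cpow_sub_le_rpow {x Δ a θ : ℝ} (hx : 1 ≤ x) (hΔ : 1 ≤ Δ) (hΔx : Δ ≤ x)
    (ha : 0 ≤ a) (ha1 : a ≤ 1) (hθ : 0 ≤ θ) (hθ1 : θ ≤ 1) (haθ : a + θ ≤ 1) (t : ℝ) :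
    ‖((x + Δ : ℝ) : ℂ) ^ (a + t * Complex.I + 1) - (x : ℂ) ^ (a + t * Complex.I + 1)‖ ≤
      8 * x ^ (a + θ) * Δ * (1 + |t|) ^ (1 - θ) := by
  have hx0 : 0 < x := by linarith
  set r : ℂ := a + t * Complex.I + 1 with hr
  have hre : r.re = a + 1 := by simp [hr]
  set d := ‖((x + Δ : ℝ) : ℂ) ^ r - (x : ℂ) ^ r‖ with hd
  have hd0 : 0 ≤ d := norm_nonneg _
  have hA : d ≤ 2 * (2 * x) ^ (a + 1) := by
    refine (norm_sub_le _ _).trans ?_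
    rw [Complex.norm_cpow_eq_rpow_re_of_pos (by linarith),
      Complex.norm_cpow_eq_rpow_re_of_pos hx0, hre, two_mul]
    gcongr <;> linarith
  have hB : d ≤ 2 * (1 + |t|) * Δ * (2 * x) ^ a := by
    have h := norm_ofReal_cpow_sub_le (a := x) (b := x + Δ) (C := (2 * x) ^ a) hx0 (by linarith) r
      (fun y hy => by
        rw [hre, add_sub_cancel_right]
        exact Real.rpow_le_rpow (hx0.le.trans hy.1) (by linarith [hy.2]) ha)
    rw [add_sub_cancel_left] at h
    have h2 : ‖r‖ ≤ 2 * (1 + |t|) := by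
      have := Complex.norm_le_abs_re_add_abs_im r
      rw [hre, abs_of_nonneg (by linarith)] at this
      have him : r.im = t := by simp [hr]
      rw [him] at this
      linarith [abs_nonneg t]
    calc d ≤ ‖r‖ * (2 * x) ^ a * Δ := h
      _ ≤ 2 * (1 + |t|) * (2 * x) ^ a * Δ := by gcongr
      _ = _ := by ring
  have hsplit : d = d ^ θ * d ^ (1 - θ) := by
    rw [← Real.rpow_add' hd0 (by simp), add_sub_cancel, Real.rpow_one]
  have hu : 0 < 1 + |t| := by positivity
  have h2a : ∀ p : ℝ, 0 ≤ p → p ≤ 1 → (2 : ℝ) ^ p ≤ 2 := fun p _ h1 => by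
    simpa using Real.rpow_le_rpow_of_exponent_le (x := 2) (by norm_num) h1
  have hΔp : Δ ^ (1 - θ) ≤ Δ := by
    simpa using Real.rpow_le_rpow_of_exponent_le (x := Δ) hΔ (by linarith : 1 - θ ≤ 1)
  calc d = d ^ θ * d ^ (1 - θ) := hsplit
    _ ≤ (2 * (2 * x) ^ (a + 1)) ^ θ * (2 * (1 + |t|) * Δ * (2 * x) ^ a) ^ (1 - θ) := by
      gcongr
    _ = 2 ^ θ * 2 ^ (1 - θ) * (2 : ℝ) ^ (a + θ) * x ^ (a + θ) * Δ ^ (1 - θ) *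
        (1 + |t|) ^ (1 - θ) := by
      have e1 : (2 * (2 * x) ^ (a + 1)) ^ θ = 2 ^ θ * (2 * x) ^ ((a + 1) * θ) := by
        rw [Real.mul_rpow (by positivity) (by positivity), ← Real.rpow_mul (by positivity)]
      have e2 : (2 * (1 + |t|) * Δ * (2 * x) ^ a) ^ (1 - θ) =
          2 ^ (1 - θ) * (1 + |t|) ^ (1 - θ) * Δ ^ (1 - θ) * (2 * x) ^ (a * (1 - θ)) := by
        rw [Real.mul_rpow (by positivity) (by positivity),
          Real.mul_rpow (by positivity) (by positivity),
          Real.mul_rpow (by positivity) (by positivity), ← Real.rpow_mul (by positivity)]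
      rw [e1, e2]
      have : a + θ = (a + 1) * θ + a * (1 - θ) := by ring
      rw [mul_assoc (2 ^ θ * 2 ^ (1 - θ)), ← Real.mul_rpow (by norm_num) hx0.le, this,
        Real.rpow_add (by positivity)]
      ring
    _ ≤ 2 * 2 * 2 * x ^ (a + θ) * Δ * (1 + |t|) ^ (1 - θ) := by
      have h1 := h2a θ hθ hθ1
      have h2 := h2a (1 - θ) (by linarith) (by linarith)
      have h3 := h2a (a + θ) (by linarith) haθ
      gcongr
    _ = _ := by ring

lemma exists_norm_cesaroError_sub_le (hRH : RiemannHypothesis') {β : ℝ} (hβ : 1 / 2 < β)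
    (hβ1 : β < 1) :
    ∃ a C : ℝ, 1 / 2 < a ∧ a ≤ 2 ∧ 0 < C ∧ ∀ x Δ : ℝ, 1 ≤ x → 1 ≤ Δ → Δ ≤ x →
      ‖cesaroError a (x + Δ) - cesaroError a x‖ ≤ C * x ^ β * Δ := by
  set ε := (β - 1 / 2) / 3 with hε
  have hε0 : 0 < ε := by rw [hε]; linarith
  set a := 1 / 2 + ε with ha
  have ha2 : 1 / 2 < a := by linarith
  have haθ : a + 2 * ε = β := by rw [ha, hε]; ring
  obtain ⟨C, hC0, hC⟩ := exists_norm_zetaLogDeriv_le hRH ha2 hε0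
  have hJ := integrable_one_add_abs_rpow (p := 1 + ε) (by linarith)
  set J := ∫ t : ℝ, (1 + |t|) ^ (-(1 + ε)) with hJdef
  have hJ0 : 0 ≤ J := MeasureTheory.integral_nonneg fun t => by positivity
  have hint : ∀ x : ℝ, 1 ≤ x → MeasureTheory.Integrable fun t : ℝ =>
      (x : ℂ) ^ (a + t * Complex.I + 1) * (zetaLogDeriv (a + t * Complex.I) *
        (1 / ((a + t * Complex.I) * (a + t * Complex.I + 1)))) := by
    intro x hx
    have hx0 : 0 < x := by linarith
    have hxc : (x : ℂ) ≠ 0 := Complex.ofReal_ne_zero.2 hx0.ne'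
    refine integrable_vertical_of_norm_le (σ := a) (p := 2 - ε) (C := x ^ (a + 1) * C)
      (f := fun s =>
      (x : ℂ) ^ (s + 1) * (zetaLogDeriv s * (1 / (s * (s + 1))))) (by linarith) ?_ ?_
    · intro s hs
      exact ((differentiableAt_id.add_const 1).const_cpow (Or.inl hxc)).mul
        (differentiableAt_zetaLogDeriv_mul hRH (by rwa [hs]))
    · intro s hs
      rw [norm_mul, Complex.norm_cpow_eq_rpow_re_of_pos hx0, Complex.add_re, hs, Complex.one_re,
        neg_sub, mul_assoc]
      gcongr
      exact hC s hs.ge (by linarith)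
  refine ⟨a, 8 * C * J + 1, ha2, by linarith, by nlinarith [mul_nonneg hC0.le hJ0],
    fun x Δ hx hΔ hΔx => ?_⟩
  rw [cesaroError, cesaroError, ← mul_sub, ← MeasureTheory.integral_sub (hint _ (by linarith))
    (hint x hx), norm_mul]
  have h1 : ‖(1 / (2 * Real.pi) : ℂ)‖ ≤ 1 := by
    rw [norm_div, norm_one, norm_mul, Complex.norm_real, Real.norm_eq_abs,
      abs_of_pos Real.pi_pos, Complex.norm_ofNat, div_le_one (by positivity)]
    linarith [Real.pi_gt_three]
  have h2 : ‖∫ t : ℝ, ((x + Δ : ℝ) : ℂ) ^ (a + t * Complex.I + 1) *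
      (zetaLogDeriv (a + t * Complex.I) *
      (1 / ((a + t * Complex.I) * (a + t * Complex.I + 1)))) -
      (x : ℂ) ^ (a + t * Complex.I + 1) * (zetaLogDeriv (a + t * Complex.I) *
      (1 / ((a + t * Complex.I) * (a + t * Complex.I + 1))))‖ ≤ 8 * x ^ β * Δ * C * J := by
    rw [hJdef, ← MeasureTheory.integral_const_mul]
    refine MeasureTheory.norm_integral_le_of_norm_le (hJ.const_mul _)
      (Filter.Eventually.of_forall fun t => ?_)
    rw [← sub_mul, norm_mul]
    have h3 := norm_ofReal_cpow_sub_le_rpow hx hΔ hΔx (by linarith : 0 ≤ a) (by linarith)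
      (by linarith : 0 ≤ 2 * ε) (by linarith) (by linarith) t
    have h4 := hC (a + t * Complex.I) (by simp) (by simp; linarith)
    have him : (a + t * Complex.I : ℂ).im = t := by simp
    rw [him] at h4
    rw [haθ] at h3
    have h5 : (1 + |t|) ^ (-(1 + ε)) = (1 + |t|) ^ (1 - 2 * ε) * (1 + |t|) ^ (ε - 2) := by
      rw [← Real.rpow_add (by positivity)]
      congr 1
      ring
    rw [h5]
    calc _ ≤ 8 * x ^ β * Δ * (1 + |t|) ^ (1 - 2 * ε) * (C * (1 + |t|) ^ (ε - 2)) := by gcongr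
      _ = _ := by ring
  calc _ ≤ 1 * (8 * x ^ β * Δ * C * J) := by gcongr
    _ ≤ 8 * C * J * (x ^ β * Δ) + x ^ β * Δ := by
      have : 0 ≤ x ^ β * Δ := by positivity
      linarith
    _ = _ := by ring

lemma hasSum_vonMangoldt_mul_max_sub (hRH : RiemannHypothesis') {a x : ℝ} (ha : 1 / 2 < a)
    (ha2 : a ≤ 2) (hx : 1 ≤ x) :
    HasSum (fun n : ℕ => ArithmeticFunction.vonMangoldt n * max (x - n) 0)
      ((x - 1) ^ 2 / 2 + (cesaroError a x).re) := by
  have hx0 : 0 < x := by linarith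
  have hxc : (x : ℂ) ≠ 0 := Complex.ofReal_ne_zero.2 hx0.ne'
  have h := Complex.hasSum_re ((hasSum_vonMangoldt_mul_max_eq hRH ha ha2 hx).mul_left (x : ℂ))
  convert h using 1
  · ext n
    rw [← Complex.ofReal_mul, Complex.ofReal_re]
    have : max (x - n) 0 = x * max (1 - n / x) 0 := by
      rw [mul_max_of_nonneg _ _ hx0.le, mul_sub, mul_div_cancel₀ _ hx0.ne', mul_one, mul_zero]
    rw [this]
    ring
  · rw [mul_add, Complex.add_re, ← Complex.ofReal_mul, Complex.ofReal_re]
    congr 1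
    · field_simp
    · rw [cesaroError, mul_left_comm, ← MeasureTheory.integral_const_mul (x : ℂ)]
      congr 2
      refine MeasureTheory.integral_congr_ae (Filter.Eventually.of_forall fun t => ?_)
      simp only
      rw [Complex.cpow_add _ _ hxc, Complex.cpow_one]
      ring

lemma psi_mul_le (hRH : RiemannHypothesis') {a x Δ : ℝ} (ha : 1 / 2 < a)
    (ha2 : a ≤ 2) (hx : 1 ≤ x) (hΔ : 0 ≤ Δ) :
    Chebyshev.psi x * Δ ≤ Δ * (x - 1) + Δ ^ 2 / 2 +
      (cesaroError a (x + Δ) - cesaroError a x).re ∧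
    Δ * (x - 1) + Δ ^ 2 / 2 + (cesaroError a (x + Δ) - cesaroError a x).re ≤
      Chebyshev.psi (x + Δ) * Δ := by
  have h := (hasSum_vonMangoldt_mul_max_sub hRH ha ha2 (x := x + Δ) (by linarith)).sub
    (hasSum_vonMangoldt_mul_max_sub hRH ha ha2 hx)
  have e : (x + Δ - 1) ^ 2 / 2 + (cesaroError a (x + Δ)).re -
      ((x - 1) ^ 2 / 2 + (cesaroError a x).re) = Δ * (x - 1) + Δ ^ 2 / 2 +
      (cesaroError a (x + Δ) - cesaroError a x).re := by
    rw [Complex.sub_re]; ring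
  rw [e] at h
  simp only [← mul_sub] at h
  have hL : ∀ n, 0 ≤ ArithmeticFunction.vonMangoldt n := fun n =>
    ArithmeticFunction.vonMangoldt_nonneg
  constructor
  · rw [Chebyshev.psi, Finset.sum_mul]
    refine (Finset.sum_le_sum fun n hn => ?_).trans (sum_le_hasSum (Finset.Ioc 0 ⌊x⌋₊)
      (fun n _ => ?_) h)
    · have : (n : ℝ) ≤ x := (Nat.le_floor_iff (by linarith)).1 (Finset.mem_Ioc.1 hn).2
      refine mul_le_mul_of_nonneg_left ?_ (hL n)
      rw [max_eq_left (by linarith), max_eq_left (by linarith)]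
      linarith
    · refine mul_nonneg (hL n) (sub_nonneg.2 (max_le_max (by linarith) le_rfl))
  · have h2 : HasSum (fun n : ℕ => ArithmeticFunction.vonMangoldt n *
      (max (x + Δ - n) 0 - max (x - n) 0)) (∑ n ∈ Finset.Ioc 0 ⌊x + Δ⌋₊,
        ArithmeticFunction.vonMangoldt n * (max (x + Δ - n) 0 - max (x - n) 0)) :=
      hasSum_sum_of_ne_finset_zero (fun n hn => by
        rcases Nat.eq_zero_or_pos n with rfl | hn0
        · simp
        have : x + Δ < n := by
          by_contra! h3
          exact hn (Finset.mem_Ioc.2 ⟨hn0, Nat.le_floor h3⟩)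
        rw [max_eq_right (by linarith), max_eq_right (by linarith), sub_self, mul_zero])
    rw [h.unique h2, Chebyshev.psi, Finset.sum_mul]
    refine Finset.sum_le_sum fun n hn => mul_le_mul_of_nonneg_left ?_ (hL n)
    have : (n : ℝ) ≤ x + Δ := (Nat.le_floor_iff (by linarith)).1 (Finset.mem_Ioc.1 hn).2
    rw [max_eq_left (by linarith)]
    linarith [le_max_left (x - n) 0]

lemma exists_abs_psi_sub_le (hRH : RiemannHypothesis') {β : ℝ} (hβ : 1 / 2 < β)
    (hβ1 : β < 1) :
    ∃ C : ℝ, 0 < C ∧ ∀ z : ℝ, 4 ≤ z → |Chebyshev.psi z - z| ≤ C * z ^ β := by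
  obtain ⟨a, C, ha, ha2, hC0, hC⟩ := exists_norm_cesaroError_sub_le hRH hβ hβ1
  refine ⟨C + 2, by linarith, fun z hz => ?_⟩
  set q := √z with hq
  have hqq : q * q = z := Real.mul_self_sqrt (by linarith)
  have hq2 : 2 ≤ q := Real.le_sqrt_of_sq_le (by linarith)
  have hqz : q ≤ z ^ β := by
    rw [hq, Real.sqrt_eq_rpow]
    exact Real.rpow_le_rpow_of_exponent_le (by linarith) hβ.le
  have hzb : 0 ≤ z ^ β := by positivity
  have h2q : 2 * q ≤ z := by nlinarith
  rw [abs_le]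
  constructor
  · have h1 := (psi_mul_le hRH ha ha2 (x := z - q) (Δ := q) (by linarith) (by linarith)).2
    have h2 := hC (z - q) q (by linarith) (by linarith) (by linarith)
    have h3 := (abs_le.1 ((Complex.abs_re_le_norm _).trans h2)).1
    have h4 : (z - q) ^ β ≤ z ^ β := by gcongr; linarith; linarith
    have h5 : C * (z - q) ^ β * q ≤ C * z ^ β * q := by gcongr
    rw [sub_add_cancel] at *
    have h6 : 0 ≤ q * (Chebyshev.psi z - z + (C + 2) * z ^ β) := by nlinarith
    have := nonneg_of_mul_nonneg_right h6 (by linarith : 0 < q)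
    linarith
  · have h1 := (psi_mul_le hRH ha ha2 (x := z) (Δ := q) (by linarith) (by linarith)).1
    have h2 := hC z q (by linarith) (by linarith) (by linarith)
    have h3 := (abs_le.1 ((Complex.abs_re_le_norm _).trans h2)).2
    have h6 : 0 ≤ q * (z + (C + 2) * z ^ β - Chebyshev.psi z) := by nlinarith
    have := nonneg_of_mul_nonneg_right h6 (by linarith : 0 < q)
    linarith

lemma exists_abs_theta_sub_le (hRH : RiemannHypothesis') {β : ℝ} (hβ : 1 / 2 < β)
    (hβ1 : β < 1) :
    ∃ C : ℝ, 0 < C ∧ ∀ z : ℝ, 4 ≤ z → |Chebyshev.theta z - z| ≤ C * z ^ β := by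
  obtain ⟨C, hC0, hC⟩ := exists_abs_psi_sub_le hRH hβ hβ1
  obtain ⟨D, hD⟩ := Chebyshev.psi_sub_theta_le_mul_sqrt
  refine ⟨C + |D|, by positivity, fun z hz => ?_⟩
  have h1 := abs_le.1 (hC z hz)
  have h2 := hD z
  have h3 := Chebyshev.theta_le_psi z
  have hqz : √z ≤ z ^ β := by
    rw [Real.sqrt_eq_rpow]
    exact Real.rpow_le_rpow_of_exponent_le (by linarith) hβ.le
  have h4 : D * √z ≤ |D| * z ^ β := by
    calc D * √z ≤ |D| * √z := by gcongr; exact le_abs_self D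
      _ ≤ _ := by gcongr
  have h5 : 0 ≤ |D| * z ^ β := by positivity
  rw [abs_le, add_mul]
  constructor <;> linarith

lemma tendsto_rpow_atTop_zero {p : ℝ} (hp : p < 0) :
    Tendsto (fun x : ℝ => x ^ p) atTop (𝓝 0) := by
  simpa using tendsto_rpow_neg_atTop (neg_pos.2 hp)

lemma tendsto_theta_sub_div (hRH : RiemannHypothesis') {γ : ℝ} (hγ : γ ∈ Set.Ioo (1 / 2 : ℝ) 1) :
    Tendsto (fun x : ℝ => (Chebyshev.theta (x + x ^ γ) - Chebyshev.theta x) / x ^ γ)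
      atTop (𝓝 1) := by
  obtain ⟨β, hβ, hβγ⟩ := exists_between hγ.1
  have hβ1 : β < 1 := hβγ.trans hγ.2
  obtain ⟨C, hC0, hC⟩ := exists_abs_theta_sub_le hRH hβ hβ1
  rw [tendsto_iff_dist_tendsto_zero]
  have hlim : Tendsto (fun x : ℝ => 3 * C * x ^ (β - γ)) atTop (𝓝 0) := by
    simpa using (tendsto_rpow_atTop_zero (p := β - γ) (by linarith)).const_mul (3 * C)
  refine squeeze_zero' (Filter.Eventually.of_forall fun _ => dist_nonneg) ?_ hlim
  filter_upwards [eventually_ge_atTop 4] with x hx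
  have hx0 : 0 < x := by linarith
  have hg : 0 < x ^ γ := by positivity
  have hgx : x ^ γ ≤ x := by
    simpa using Real.rpow_le_rpow_of_exponent_le (by linarith : 1 ≤ x) hγ.2.le
  have h1 := hC x hx
  have h2 := hC (x + x ^ γ) (by linarith)
  have h3 : (x + x ^ γ) ^ β ≤ 2 * x ^ β := by
    calc (x + x ^ γ) ^ β ≤ (2 * x) ^ β := by gcongr; linarith
      _ = 2 ^ β * x ^ β := Real.mul_rpow (by norm_num) hx0.le
      _ ≤ 2 * x ^ β := by
        gcongr
        simpa using Real.rpow_le_rpow_of_exponent_le (x := 2) (by norm_num) hβ1.le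
  rw [Real.dist_eq, div_sub_one hg.ne', abs_div, abs_of_pos hg, Real.rpow_sub hx0,
    ← mul_div_assoc, div_le_div_iff_of_pos_right hg]
  have h4 : C * (x + x ^ γ) ^ β ≤ C * (2 * x ^ β) := by gcongr
  rw [abs_le] at *
  constructor <;> linarith [h1.1, h1.2, h2.1, h2.2]

lemma theta_sub_theta {x y : ℝ} (hxy : x ≤ y) : Chebyshev.theta y - Chebyshev.theta x =
    ∑ p ∈ (Finset.Ioc ⌊x⌋₊ ⌊y⌋₊).filter Nat.Prime, Real.log p := by
  simp only [Chebyshev.theta, Finset.sum_filter]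
  rw [sub_eq_iff_eq_add', Finset.sum_Ioc_consecutive _ (Nat.zero_le _) (Nat.floor_mono hxy)]

lemma leastPrime_spec {x : ℝ} : x ≤ leastPrime x := by
  have hne : {p : ℕ | p.Prime ∧ x ≤ (p : ℝ)}.Nonempty := by
    obtain ⟨p, hp, hpp⟩ := Nat.exists_infinite_primes ⌈x⌉₊
    exact ⟨p, hpp, (Nat.le_ceil x).trans (by exact_mod_cast hp)⟩
  exact (Nat.sInf_mem hne).2

lemma leastPrime_le {x : ℝ} {p : ℕ} (hp : p.Prime) (hx : x ≤ p) : leastPrime x ≤ p :=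
  Nat.sInf_le ⟨hp, hx⟩

lemma tendsto_leastPrime_div (hRH : RiemannHypothesis') :
    Tendsto (fun x : ℝ => leastPrime x / x) atTop (𝓝 1) := by
  have hγ : (3 / 4 : ℝ) ∈ Set.Ioo (1 / 2 : ℝ) 1 := by constructor <;> norm_num
  have hlim : Tendsto (fun x : ℝ => 1 + x ^ (3 / 4 - 1 : ℝ)) atTop (𝓝 1) := by
    simpa using (tendsto_rpow_atTop_zero (p := 3 / 4 - 1) (by norm_num)).const_add 1
  refine tendsto_of_tendsto_of_tendsto_of_le_of_le' tendsto_const_nhds hlim ?_ ?_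
  · filter_upwards [eventually_gt_atTop 0] with x hx
    rw [le_div_iff₀ hx, one_mul]
    exact leastPrime_spec
  · filter_upwards [eventually_gt_atTop 0,
      (tendsto_theta_sub_div hRH hγ).eventually (lt_mem_nhds zero_lt_one)] with x hx h
    have hg : 0 < x ^ (3 / 4 : ℝ) := by positivity
    have h1 : 0 < Chebyshev.theta (x + x ^ (3 / 4 : ℝ)) - Chebyshev.theta x := by
      rwa [div_pos_iff_of_pos_right hg] at h
    rw [theta_sub_theta (by linarith)] at h1
    obtain ⟨p, hp⟩ := Finset.nonempty_of_sum_ne_zero h1.ne'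
    rw [Finset.mem_filter, Finset.mem_Ioc] at hp
    have h2 : x ≤ p := ((Nat.floor_lt hx.le).1 hp.1.1).le
    have h3 : (p : ℝ) ≤ x + x ^ (3 / 4 : ℝ) := (Nat.le_floor_iff (by linarith)).1 hp.1.2
    have h4 : (leastPrime x : ℝ) ≤ p := by exact_mod_cast leastPrime_le hp.2 h2
    rw [Real.rpow_sub hx, Real.rpow_one, div_le_iff₀ hx, add_mul, div_mul_cancel₀ _ hx.ne', one_mul]
    exact h4.trans h3

/-- The primes in `[X, X + X ^ δ]`. -/
noncomputable def shortPrimes (X δ : ℝ) : Finset ℕ :=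
  (Finset.range (Nat.floor (X + X ^ δ) + 1)).filter
    (fun N : ℕ => N.Prime ∧ X ≤ (N : ℝ) ∧ (N : ℝ) ≤ X + X ^ δ)

lemma mem_shortPrimes {X δ : ℝ} {N : ℕ} :
    N ∈ shortPrimes X δ ↔ N.Prime ∧ X ≤ (N : ℝ) ∧ (N : ℝ) ≤ X + X ^ δ := by
  rw [shortPrimes, Finset.mem_filter, Finset.mem_range, Nat.lt_succ_iff, and_iff_right_iff_imp]
  exact fun h => Nat.le_floor h.2.2

lemma theta_sub_theta_le_sum_shortPrimes {X δ : ℝ} (hX : 1 ≤ X) :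
    Chebyshev.theta (X + X ^ δ) - Chebyshev.theta X ≤ ∑ p ∈ shortPrimes X δ, Real.log p ∧
    ∑ p ∈ shortPrimes X δ, Real.log p ≤
      Chebyshev.theta (X + X ^ δ) - Chebyshev.theta X + Real.log X := by
  have hg : 0 < X ^ δ := by positivity
  rw [theta_sub_theta (by linarith)]
  constructor
  · refine Finset.sum_le_sum_of_subset_of_nonneg (fun p hp => ?_)
      fun p _ _ => Real.log_natCast_nonneg p
    rw [Finset.mem_filter, Finset.mem_Ioc] at hp
    rw [mem_shortPrimes]
    exact ⟨hp.2, ((Nat.floor_lt (by linarith)).1 hp.1.1).le,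
      (Nat.le_floor_iff (by linarith)).1 hp.1.2⟩
  · have hsub : shortPrimes X δ ⊆
        insert ⌊X⌋₊ ((Finset.Ioc ⌊X⌋₊ ⌊X + X ^ δ⌋₊).filter Nat.Prime) := by
      intro p hp
      rw [mem_shortPrimes] at hp
      have h1 : ⌊X⌋₊ ≤ p := by
        have := Nat.floor_mono hp.2.1
        rwa [Nat.floor_natCast] at this
      rcases h1.eq_or_lt with h | h
      · simp [h]
      · exact Finset.mem_insert_of_mem (Finset.mem_filter.2
          ⟨Finset.mem_Ioc.2 ⟨h, Nat.le_floor hp.2.2⟩, hp.1⟩)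
    refine (Finset.sum_le_sum_of_subset_of_nonneg hsub
      fun p _ _ => Real.log_natCast_nonneg p).trans ?_
    rw [Finset.sum_insert (by simp), add_comm]
    gcongr
    · exact_mod_cast Nat.floor_pos.2 hX
    · exact Nat.floor_le (by linarith)

lemma tendsto_card_shortPrimes (hRH : RiemannHypothesis') {δ : ℝ}
    (hδ : δ ∈ Set.Ioo (1 / 2 : ℝ) 1) :
    Tendsto (fun X : ℝ => Real.log X / X ^ δ * #(shortPrimes X δ)) atTop (𝓝 1) := by
  have h0 := tendsto_theta_sub_div hRH hδ
  have hlog : Tendsto (fun X : ℝ => Real.log X / X ^ δ) atTop (𝓝 0) :=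
    (isLittleO_log_rpow_atTop (by linarith [hδ.1])).tendsto_div_nhds_zero
  have hratio : Tendsto (fun X : ℝ => Real.log X / (Real.log 2 + Real.log X)) atTop (𝓝 1) := by
    have h1 : Tendsto (fun X : ℝ => Real.log 2 / (Real.log 2 + Real.log X)) atTop (𝓝 0) :=
      tendsto_const_nhds.div_atTop (tendsto_atTop_add_const_left _ _ Real.tendsto_log_atTop)
    have h2 := h1.const_sub 1
    rw [sub_zero] at h2
    refine h2.congr' ?_
    filter_upwards [eventually_gt_atTop 1] with X hX
    have := Real.log_pos hX
    have := Real.log_pos one_lt_two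
    field_simp
    ring
  have hupper := h0.add hlog
  have hlower := h0.mul hratio
  rw [add_zero] at hupper
  rw [mul_one] at hlower
  refine tendsto_of_tendsto_of_tendsto_of_le_of_le' hlower hupper ?_ ?_
  · filter_upwards [eventually_gt_atTop 1] with X hX
    have hg : 0 < X ^ δ := by positivity
    have hgx : X ^ δ ≤ X := by
      simpa using Real.rpow_le_rpow_of_exponent_le hX.le hδ.2.le
    have hl := Real.log_pos hX
    have hl2 := Real.log_pos one_lt_two
    have h1 : ∑ p ∈ shortPrimes X δ, Real.log p ≤
        #(shortPrimes X δ) * (Real.log 2 + Real.log X) := by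
      rw [← nsmul_eq_mul]
      refine Finset.sum_le_card_nsmul _ _ _ fun p hp => ?_
      rw [mem_shortPrimes] at hp
      rw [← Real.log_mul (by norm_num) (by linarith)]
      refine Real.log_le_log ?_ (by linarith [hp.2.2])
      linarith [hp.2.1]
    have h2 := (theta_sub_theta_le_sum_shortPrimes (δ := δ) hX.le).1.trans h1
    rw [div_mul_div_comm, div_mul_eq_mul_div, div_le_div_iff₀ (by positivity) hg]
    calc _ ≤ #(shortPrimes X δ) * (Real.log 2 + Real.log X) * Real.log X * X ^ δ := by gcongr
      _ = _ := by ring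
  · filter_upwards [eventually_gt_atTop 1] with X hX
    have hg : 0 < X ^ δ := by positivity
    have h1 : #(shortPrimes X δ) * Real.log X ≤ ∑ p ∈ shortPrimes X δ, Real.log p := by
      rw [← nsmul_eq_mul]
      refine Finset.card_nsmul_le_sum _ _ _ fun p hp => ?_
      rw [mem_shortPrimes] at hp
      exact Real.log_le_log (by linarith) hp.2.1
    have h2 := h1.trans (theta_sub_theta_le_sum_shortPrimes (δ := δ) hX.le).2
    rw [← add_div, div_mul_eq_mul_div, div_le_div_iff_of_pos_right hg]
    linarith

lemma abs_mul_sin_sub_le {X δ y p N : ℝ} (hX : 1 ≤ X) (hy : 0 < y) (h1 : X ≤ N)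
    (h2 : N ≤ X + X ^ δ) :
    |(N - 1) / N * Real.sin (2 * Real.pi * (p / N)) - Real.sin (2 * Real.pi * y)| ≤
      1 / X + 2 * Real.pi * (|p / X - y| + y * X ^ (δ - 1)) := by
  have hX0 : 0 < X := by linarith
  have hN : 0 < N := by linarith
  have hd : |p / N - y| ≤ |p / X - y| + y * X ^ (δ - 1) := by
    have e : p / N - y = X / N * (p / X - y) - y * ((N - X) / N) := by
      field_simp
      ring
    have h3 : |X / N * (p / X - y)| ≤ |p / X - y| := by
      rw [abs_mul, abs_of_pos (by positivity)]
      exact mul_le_of_le_one_left (abs_nonneg _) ((div_le_one hN).2 h1)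
    have h4 : |y * ((N - X) / N)| ≤ y * X ^ (δ - 1) := by
      rw [abs_of_nonneg (mul_nonneg hy.le (div_nonneg (by linarith) hN.le)), Real.rpow_sub hX0,
        Real.rpow_one]
      have h5 : 0 < X ^ δ := by positivity
      gcongr
      linarith
    rw [e]
    exact (abs_sub _ _).trans (add_le_add h3 h4)
  have e : (N - 1) / N * Real.sin (2 * Real.pi * (p / N)) - Real.sin (2 * Real.pi * y) =
      (Real.sin (2 * Real.pi * (p / N)) - Real.sin (2 * Real.pi * y)) -
      1 / N * Real.sin (2 * Real.pi * (p / N)) := by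
    field_simp
    ring
  have h5 : |Real.sin (2 * Real.pi * (p / N)) - Real.sin (2 * Real.pi * y)| ≤
      2 * Real.pi * |p / N - y| := by
    refine (Real.abs_sin_sub_sin_le _ _).trans (le_of_eq ?_)
    rw [← mul_sub, abs_mul, abs_of_pos (by positivity)]
  have h6 : |1 / N * Real.sin (2 * Real.pi * (p / N))| ≤ 1 / X := by
    rw [abs_mul, abs_of_pos (by positivity)]
    calc 1 / N * |Real.sin (2 * Real.pi * (p / N))| ≤ 1 / N * 1 := by
          gcongr
          exact Real.abs_sin_le_one _
      _ ≤ 1 / X := by rw [mul_one]; gcongr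
  rw [e]
  refine (abs_sub _ _).trans ?_
  have h7 := mul_le_mul_of_nonneg_left hd (by positivity : 0 ≤ 2 * Real.pi)
  linarith

end Murmuration

open Murmuration in
theorem murmuration_PminusTilde (hRH : RiemannHypothesis') (y δ : ℝ) (hy : 0 < y)
    (hδ : δ ∈ Set.Ioo (1 / 2 : ℝ) 1) :
    Tendsto (fun X : ℝ => PminusTilde y X δ) atTop
      (𝓝 (-Complex.I * Complex.ofReal (Real.sin (2 * Real.pi * y)))) := by
  set g : ℝ → ℝ := fun X =>
    1 / X + 2 * Real.pi * (|leastPrime (y * X) / X - y| + y * X ^ (δ - 1)) with hg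
  have hcard := tendsto_card_shortPrimes hRH hδ
  have hp : Tendsto (fun X : ℝ => (leastPrime (y * X) : ℝ) / X) atTop (𝓝 y) := by
    have h1 := ((tendsto_leastPrime_div hRH).comp (tendsto_id.const_mul_atTop hy)).const_mul y
    rw [mul_one] at h1
    refine h1.congr fun X => ?_
    simp only [Function.comp, id]
    field_simp
  have hg0 : Tendsto g atTop (𝓝 0) := by
    have h1 : Tendsto (fun X : ℝ => 1 / X) atTop (𝓝 0) := by
      simpa using tendsto_inv_atTop_zero (𝕜 := ℝ)
    have h2 := (hp.sub_const y).abs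
    have h3 := (tendsto_rpow_atTop_zero (p := δ - 1) (by linarith [hδ.2])).const_mul y
    rw [sub_self, abs_zero] at h2
    rw [mul_zero] at h3
    simpa only [add_zero, mul_zero] using h1.add ((h2.add h3).const_mul (2 * Real.pi))
  set L : ℂ := -Complex.I * Complex.ofReal (Real.sin (2 * Real.pi * y)) with hL
  have hmain : Tendsto (fun X : ℝ => ((Real.log X / X ^ δ * #(shortPrimes X δ) : ℝ) : ℂ) * L)
      atTop (𝓝 L) := by
    simpa using (Complex.continuous_ofReal.continuousAt.tendsto.comp hcard).mul_const L
  have hdiff : Tendsto (fun X : ℝ => PminusTilde y X δ -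
      ((Real.log X / X ^ δ * #(shortPrimes X δ) : ℝ) : ℂ) * L) atTop (𝓝 0) := by
    refine squeeze_zero_norm' ?_ (by simpa using hcard.mul hg0)
    filter_upwards [eventually_gt_atTop 1] with X hX
    have hc : 0 ≤ Real.log X / X ^ δ := div_nonneg (Real.log_nonneg hX.le) (by positivity)
    have e : PminusTilde y X δ - ((Real.log X / X ^ δ * #(shortPrimes X δ) : ℝ) : ℂ) * L =
        ((Real.log X / X ^ δ : ℝ) : ℂ) * ∑ N ∈ shortPrimes X δ,
          (-Complex.I * (((N - 1) / N * Real.sin (2 * Real.pi * (leastPrime (y * X) / N)) -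
            Real.sin (2 * Real.pi * y) : ℝ) : ℂ)) := by
      rw [PminusTilde, ← shortPrimes, Finset.sum_congr rfl fun N hN => sum_odd_char_div_gaussSum
        (mem_shortPrimes.1 hN).1 (leastPrime (y * X))]
      have : ((Real.log X / X ^ δ * #(shortPrimes X δ) : ℝ) : ℂ) * L =
          ((Real.log X / X ^ δ : ℝ) : ℂ) * ∑ N ∈ shortPrimes X δ, L := by
        rw [Finset.sum_const, nsmul_eq_mul]
        push_cast
        ring
      rw [this, ← mul_sub, ← Finset.sum_sub_distrib]
      congr 1
      refine Finset.sum_congr rfl fun N _ => ?_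
      rw [hL, ← mul_sub, ← Complex.ofReal_sub]
    rw [e, norm_mul, Complex.norm_real, Real.norm_eq_abs, abs_of_nonneg hc,
      mul_assoc (Real.log X / X ^ δ)]
    refine mul_le_mul_of_nonneg_left ?_ hc
    refine (norm_sum_le_of_le _ (f := fun N : ℕ => -Complex.I *
      (((N - 1) / N * Real.sin (2 * Real.pi * (leastPrime (y * X) / N)) -
            Real.sin (2 * Real.pi * y) : ℝ) : ℂ)) (n := fun _ => g X) fun N hN => ?_).trans
      (le_of_eq (by rw [Finset.sum_const, nsmul_eq_mul]))
    rw [norm_mul, norm_neg, Complex.norm_I, one_mul, Complex.norm_real, Real.norm_eq_abs]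
    have hN' := mem_shortPrimes.1 hN
    exact abs_mul_sin_sub_le hX.le hy hN'.2.1 hN'.2.2
  simpa using hdiff.add hmain
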